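/- arXiv:2503.10113 — 2 statements merged into one kernel-verified Lean document; each statement's English description precedes it below -/
import Mathlib

section
/- For all integers n ≥ 0, β ≥ 0 and k ≥ 1, the number 24 divides 18·5^{2k+β-1} + 5^{2k-1} + 1, and p_{1,5^{2k-1}}(5^{2k+β-1}·n + (18·5^{2k+β-1} + 5^{2k-1} + 1)/24) ≡ 0 (mod 5^{2k+β-1}). -/
open PowerSeries

/-- Number of 2-color partitions of `n` in which the second color is used only on
parts that are multiples of `ℓ`: pairs `(λ, μ)` of partitions with `|λ| + |μ| = n`
and every part of `μ` divisible by `ℓ`. -/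
def p1 (ℓ n : ℕ) : ℕ :=
  ∑ a ∈ Finset.range (n + 1),
    Fintype.card (Nat.Partition a) *
      Fintype.card {μ : Nat.Partition (n - a) // ∀ i ∈ μ.parts, ℓ ∣ i}

/-- The finite Euler product `∏_{i=1}^{n} (1 - q^i)`. -/
noncomputable def eulerProd (R : Type*) [CommRing R] (n : ℕ) : R⟦X⟧ :=
  ∏ i ∈ Finset.range n, (1 - X ^ (i + 1))

theorem eulerProd_succ (R : Type*) [CommRing R] (n : ℕ) :
    eulerProd R (n + 1) = eulerProd R n * (1 - X ^ (n + 1)) :=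
  Finset.prod_range_succ _ _

/-- Reduction of power series modulo `X ^ M`. -/
noncomputable abbrev modXPow (R : Type*) [CommRing R] (M : ℕ) :
    R⟦X⟧ →+* R⟦X⟧ ⧸ Ideal.span {(X : R⟦X⟧) ^ M} :=
  Ideal.Quotient.mk _

theorem modXPow_eq_iff {R : Type*} [CommRing R] {M : ℕ} {f g : R⟦X⟧} :
    modXPow R M f = modXPow R M g ↔ ∀ m < M, coeff m f = coeff m g := by
  rw [Ideal.Quotient.mk_eq_mk_iff_sub_mem, Ideal.mem_span_singleton, X_pow_dvd_iff]
  simp [sub_eq_zero]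

theorem modXPow_X_pow_eq_zero {R : Type*} [CommRing R] {M n : ℕ} (h : M ≤ n) :
    modXPow R M (X ^ n) = 0 :=
  Ideal.Quotient.eq_zero_iff_mem.2 (Ideal.mem_span_singleton.2 (pow_dvd_pow _ h))

theorem modXPow_eulerProd {R : Type*} [CommRing R] {M n : ℕ} (h : M ≤ n) :
    modXPow R M (eulerProd R n) = modXPow R M (pentagonalSeries R) := by
  have key (s : Finset ℕ) (hs : Finset.range n ⊆ s) :
      modXPow R M (∏ i ∈ s, (1 - X ^ (i + 1))) = modXPow R M (eulerProd R n) := by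
    rw [← Finset.prod_sdiff hs, map_mul, eulerProd, map_prod _ _ (s \ _),
      Finset.prod_eq_one, one_mul]
    intro i hi
    simp only [Finset.mem_sdiff, Finset.mem_range, not_lt] at hi
    rw [map_sub, modXPow_X_pow_eq_zero (by omega), map_one, sub_zero]
  rw [modXPow_eq_iff]
  intro m hm
  obtain ⟨s, hs, hn⟩ := ((coeff_prod_one_sub_X_pow_eventually_eq R m).and
    (Filter.eventually_ge_atTop (Finset.range n))).exists
  rw [← hs]
  exact (modXPow_eq_iff.1 (key s hn) m hm).symm

theorem eq_of_modXPow_eq {R : Type*} [CommRing R] {f g : R⟦X⟧}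
    (h : ∀ M, modXPow R M f = modXPow R M g) : f = g := by
  ext n
  exact modXPow_eq_iff.1 (h (n + 1)) n n.lt_succ_self

/-- The generating function of the partition function. -/
noncomputable def partitionSeries : ℤ⟦X⟧ := mk fun n ↦ (Fintype.card (Nat.Partition n) : ℤ)

open PowerSeries.WithPiTopology in
theorem pentagonalSeries_mul_partitionSeries : pentagonalSeries ℤ * partitionSeries = 1 := by
  have h1 := hasProd_one_sub_X_pow ℤ
  have h2 := Nat.Partition.hasProd_powerSeriesMk_card_restricted ℤ (fun _ ↦ True)
  have h3 := h1.mul h2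
  have : partitionSeries = mk fun n ↦ ((Nat.Partition.restricted n fun _ ↦ True).card : ℤ) := by
    ext n
    simp [partitionSeries, Nat.Partition.restricted]
  rw [this]
  refine h3.unique ?_
  convert hasProd_one with i
  simp only [if_true, pow_mul]
  exact PowerSeries.WithPiTopology.one_sub_mul_tsum_pow_of_constantCoeff_eq_zero (by simp)

theorem card_partition_dvd_parts {l : ℕ} (hl : l ≠ 0) (n : ℕ) :
    Fintype.card {μ : Nat.Partition (l * n) // ∀ i ∈ μ.parts, l ∣ i} =
      Fintype.card (Nat.Partition n) := by
  have hpos := Nat.pos_of_ne_zero hl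
  symm
  let f (p : Nat.Partition n) : {μ : Nat.Partition (l * n) // ∀ i ∈ μ.parts, l ∣ i} :=
    ⟨⟨p.parts.map (l * ·), by
        simp only [Multiset.mem_map]
        rintro _ ⟨a, ha, rfl⟩
        exact Nat.mul_pos hpos (p.parts_pos ha), by
        rw [Multiset.sum_map_mul_left, Multiset.map_id', p.parts_sum]⟩, by
      simp only [Multiset.mem_map]
      rintro _ ⟨a, -, rfl⟩
      exact dvd_mul_right _ _⟩
  refine Fintype.card_of_bijective (f := f) ⟨fun p q h ↦ ?_, fun μ ↦ ?_⟩
  · have h' : p.parts.map (l * ·) = q.parts.map (l * ·) :=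
      congrArg (fun μ ↦ μ.1.parts) h
    exact Nat.Partition.ext (Multiset.map_injective (mul_right_injective₀ hl) h')
  · have hmap : (μ.1.parts.map (· / l)).map (l * ·) = μ.1.parts := by
      rw [Multiset.map_map]
      conv_rhs => rw [← Multiset.map_id μ.1.parts]
      exact Multiset.map_congr rfl fun i hi ↦ Nat.mul_div_cancel' (μ.2 i hi)
    refine ⟨⟨μ.1.parts.map (· / l), ?_, ?_⟩, Subtype.ext (Nat.Partition.ext hmap)⟩
    · simp only [Multiset.mem_map]
      rintro _ ⟨a, ha, rfl⟩
      exact Nat.div_pos (Nat.le_of_dvd (μ.1.parts_pos ha) (μ.2 a ha)) hpos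
    · apply Nat.eq_of_mul_eq_mul_left hpos
      have hsum := congrArg Multiset.sum hmap
      rwa [Multiset.sum_map_mul_left, Multiset.map_id', μ.1.parts_sum] at hsum

theorem coeff_expand_partitionSeries {l : ℕ} (hl : l ≠ 0) (n : ℕ) :
    coeff n (expand l hl partitionSeries) =
      (Fintype.card {μ : Nat.Partition n // ∀ i ∈ μ.parts, l ∣ i} : ℤ) := by
  by_cases h : l ∣ n
  · obtain ⟨m, rfl⟩ := h
    rw [coeff_expand_mul, card_partition_dvd_parts hl, partitionSeries, coeff_mk]
  · have : IsEmpty {μ : Nat.Partition n // ∀ i ∈ μ.parts, l ∣ i} :=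
      ⟨fun μ ↦ h (μ.1.parts_sum ▸ Multiset.dvd_sum μ.2)⟩
    rw [coeff_expand_of_not_dvd _ _ _ h, Fintype.card_eq_zero, Nat.cast_zero]

theorem coeff_partitionSeries_mul_expand {l : ℕ} (hl : l ≠ 0) (n : ℕ) :
    coeff n (partitionSeries * expand l hl partitionSeries) = (p1 l n : ℤ) := by
  rw [coeff_mul, p1, Finset.Nat.sum_antidiagonal_eq_sum_range_succ_mk]
  simp only [coeff_expand_partitionSeries]
  push_cast
  simp [partitionSeries]

/-- The Gaussian binomial coefficient `[2n+1, n-k]`, defined by a recursion in `n` of step two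
rows of the Pascal triangle. -/
noncomputable def oddGauss : ℕ → ℕ → ℤ⟦X⟧
  | 0, 0 => 1
  | 0, _ + 1 => 0
  | n + 1, 0 => (1 + X ^ (2 * n + 2) + X ^ (n + 1)) * oddGauss n 0 + X ^ (n + 2) * oddGauss n 1
  | n + 1, k + 1 => (1 + X ^ (2 * n + 2)) * oddGauss n (k + 1) + X ^ (n - k) * oddGauss n k +
      X ^ (n + k + 3) * oddGauss n (k + 2)

theorem oddGauss_eq_zero : ∀ {n k : ℕ}, n < k → oddGauss n k = 0
  | 0, k + 1, _ => by simp [oddGauss]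
  | n + 1, k + 1, h => by
    simp [oddGauss, oddGauss_eq_zero (show n < k + 1 by omega),
      oddGauss_eq_zero (show n < k by omega), oddGauss_eq_zero (show n < k + 2 by omega)]

theorem eulerProd_mul_oddGauss (d k : ℕ) :
    eulerProd ℤ d * eulerProd ℤ (2 * k + d + 1) * oddGauss (k + d) k =
      eulerProd ℤ (2 * (k + d) + 1) := by
  induction hn : k + d generalizing d k with
  | zero =>
    obtain ⟨rfl, rfl⟩ : k = 0 ∧ d = 0 := by omega
    simp [oddGauss, eulerProd]
  | succ n ih =>
    have e1 : eulerProd ℤ (2 * (n + 1) + 1) =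
        eulerProd ℤ (2 * n + 1) * (1 - X ^ (2 * n + 2)) * (1 - X ^ (2 * n + 3)) := by
      rw [show 2 * (n + 1) + 1 = 2 * n + 1 + 1 + 1 by ring, eulerProd_succ, eulerProd_succ]
    have next (d k : ℕ) (h : k + d = n) :
        eulerProd ℤ d * eulerProd ℤ (2 * k + d + 2) * oddGauss n (k + 1) =
          eulerProd ℤ (2 * n + 1) * (1 - X ^ d) := by
      obtain _ | d := d
      · simp [oddGauss_eq_zero (show n < k + 1 by omega)]
      · have := ih d (k + 1) (by omega)
        rw [show 2 * (k + 1) + d + 1 = 2 * k + (d + 1) + 2 by ring] at this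
        rw [eulerProd_succ, ← this]
        ring
    rw [e1]
    obtain _ | k := k
    · obtain rfl : d = n + 1 := by omega
      have h0 := ih n 0 (by omega)
      have h1 := next n 0 (by omega)
      simp only [mul_zero, zero_add] at h0 h1 ⊢
      rw [oddGauss, eulerProd_succ]
      rw [eulerProd_succ _ (n + 1)] at h1 ⊢
      linear_combination (1 - X ^ (n + 1)) * (1 - X ^ (n + 2)) *
        (1 + X ^ (2 * n + 2) + X ^ (n + 1)) * h0 + X ^ (n + 2) * (1 - X ^ (n + 1)) * h1
    · obtain _ | d := d
      · obtain rfl : k = n := by omega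
        have h0 := ih 0 k (by omega)
        simp only [add_zero] at h0 ⊢
        rw [oddGauss, oddGauss_eq_zero (show k < k + 1 by omega),
          oddGauss_eq_zero (show k < k + 2 by omega), Nat.sub_self, ← h0,
          show 2 * (k + 1) + 1 = 2 * k + 1 + 1 + 1 by ring, eulerProd_succ _ (2 * k + 1 + 1),
          eulerProd_succ _ (2 * k + 1)]
        ring
      · have h0 := ih (d + 1) k (by omega)
        have h1 := ih d (k + 1) (by omega)
        have h2 := next d (k + 1) (by omega)
        obtain rfl : n = k + d + 1 := by omega
        rw [oddGauss, show k + d + 1 - k = d + 1 by omega]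
        rw [show 2 * (k + 1) + (d + 1) + 1 = 2 * k + d + 2 + 1 + 1 by ring]
        rw [show 2 * (k + 1) + d + 1 = 2 * k + d + 2 + 1 by ring] at h1
        rw [show 2 * (k + 1) + d + 2 = 2 * k + d + 2 + 1 + 1 by ring] at h2
        rw [show 2 * k + (d + 1) + 1 = 2 * k + d + 2 by ring] at h0
        simp only [eulerProd_succ _ d, eulerProd_succ _ (2 * k + d + 2 + 1),
          eulerProd_succ _ (2 * k + d + 2)] at h0 h1 h2 ⊢
        linear_combination (1 - X ^ (2 * k + d + 3)) * (1 - X ^ (2 * k + d + 4)) * X ^ (d + 1) * h0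
          + (1 - X ^ (d + 1)) * (1 - X ^ (2 * k + d + 4)) * (1 + X ^ (2 * (k + d + 1) + 2)) * h1
          + (1 - X ^ (d + 1)) * X ^ (k + d + 1 + k + 3) * h2

/-- The term `(-1)^k q^{k(k+1)/2}` of Jacobi's series. -/
noncomputable def triangularTerm (k : ℕ) : ℤ⟦X⟧ := (-1) ^ k * X ^ (k * (k + 1) / 2)

theorem triangularTerm_succ (k : ℕ) :
    triangularTerm (k + 1) = -X ^ (k + 1) * triangularTerm k := by
  have : (k + 1) * (k + 1 + 1) / 2 = k * (k + 1) / 2 + (k + 1) := by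
    rw [show (k + 1) * (k + 1 + 1) = k * (k + 1) + 2 * (k + 1) by ring,
      Nat.add_mul_div_left _ _ two_pos]
  rw [triangularTerm, triangularTerm, this]
  ring

theorem sum_triangularTerm_mul_oddGauss_succ (n m : ℕ) :
    ∑ k ∈ Finset.range (m + 1), (2 * k + 1) * triangularTerm k * oddGauss (n + 1) k =
      (1 - X ^ (n + 1)) ^ 2 *
        ∑ k ∈ Finset.range (m + 1), (2 * k + 1) * triangularTerm k * oddGauss n k +
      X ^ (n + 1) * ((2 * (m : ℤ⟦X⟧) + 3) * triangularTerm m * oddGauss n m -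
        (2 * (m : ℤ⟦X⟧) + 1) * triangularTerm (m + 1) * oddGauss n (m + 1)) := by
  induction m with
  | zero =>
    simp only [zero_add, Finset.sum_range_one, oddGauss, triangularTerm_succ]
    simp [triangularTerm]
    ring
  | succ m ih =>
    rw [Finset.sum_range_succ, Finset.sum_range_succ _ (m + 1), ih, oddGauss]
    have h : X ^ (m + 1) * (X ^ (n - m) * oddGauss n m) = X ^ (n + 1) * oddGauss n m := by
      rcases le_or_gt m n with h | h
      · rw [← mul_assoc, ← pow_add]
        congr 2
        omega
      · simp [oddGauss_eq_zero h]
    simp only [triangularTerm_succ]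
    push_cast
    linear_combination -(2 * (m : ℤ⟦X⟧) + 3) * triangularTerm m * h

theorem sum_triangularTerm_mul_oddGauss (n : ℕ) :
    ∑ k ∈ Finset.range (n + 1), (2 * k + 1) * triangularTerm k * oddGauss n k =
      eulerProd ℤ n ^ 2 := by
  induction n with
  | zero => simp [oddGauss, triangularTerm, eulerProd]
  | succ n ih =>
    rw [sum_triangularTerm_mul_oddGauss_succ, Finset.sum_range_succ, ih, eulerProd_succ,
      oddGauss_eq_zero (show n < n + 1 by omega), oddGauss_eq_zero (show n < n + 1 + 1 by omega)]
    ring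

theorem modXPow_pentagonalSeries_mul_oddGauss {M n k : ℕ} (h : M + k ≤ n) :
    modXPow ℤ M (pentagonalSeries ℤ * oddGauss n k) = 1 := by
  obtain ⟨d, rfl⟩ : ∃ d, n = k + d := ⟨n - k, by omega⟩
  have h1 := congrArg (modXPow ℤ M) (eulerProd_mul_oddGauss d k)
  have h2 := congrArg (modXPow ℤ M) pentagonalSeries_mul_partitionSeries
  simp only [map_mul, map_one] at h1 h2 ⊢
  rw [modXPow_eulerProd (by omega), modXPow_eulerProd (by omega), modXPow_eulerProd (by omega)]
    at h1
  linear_combination modXPow ℤ M partitionSeries * h1 -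
    (modXPow ℤ M (pentagonalSeries ℤ) * modXPow ℤ M (oddGauss (k + d) k) - 1) * h2

/-- Jacobi's identity for the cube of the Euler product, up to any given order. -/
theorem modXPow_pentagonalSeries_pow_three (M : ℕ) :
    modXPow ℤ M (pentagonalSeries ℤ ^ 3) =
      modXPow ℤ M (∑ k ∈ Finset.range (2 * M + 1), (2 * k + 1) * triangularTerm k) := by
  have h := congrArg (fun f ↦ modXPow ℤ M (pentagonalSeries ℤ * f))
    (sum_triangularTerm_mul_oddGauss (2 * M))
  simp only [map_mul, map_pow, modXPow_eulerProd (show M ≤ 2 * M by omega)] at h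
  rw [map_pow, pow_succ', ← h, map_sum, map_sum, Finset.mul_sum]
  refine Finset.sum_congr rfl fun k _ ↦ ?_
  rcases le_or_gt k M with hk | hk
  · have := modXPow_pentagonalSeries_mul_oddGauss (show M + k ≤ 2 * M by omega)
    rw [map_mul] at this
    rw [map_mul _ _ (oddGauss _ _)]
    linear_combination modXPow ℤ M ((2 * k + 1) * triangularTerm k) * this
  · have : modXPow ℤ M (triangularTerm k) = 0 := by
      have : M ≤ k * (k + 1) / 2 := by
        rw [Nat.le_div_iff_mul_le two_pos]
        nlinarith
      rw [triangularTerm, map_mul, modXPow_X_pow_eq_zero this, mul_zero]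
    simp [this]

theorem coeff_pentagonalSeries_pow_three {m : ℕ} (hm : m % 5 = 2) :
    coeff m (pentagonalSeries ℤ ^ 3) = 0 := by
  rw [modXPow_eq_iff.1 (modXPow_pentagonalSeries_pow_three (m + 1)) m m.lt_succ_self, map_sum]
  refine Finset.sum_eq_zero fun k _ ↦ ?_
  have hne : m ≠ k * (k + 1) / 2 := by
    rintro rfl
    have h2 : k * (k + 1) / 2 * 2 = k * (k + 1) := Nat.div_two_mul_two_of_even k.even_mul_succ_self
    have h4 : k * (k + 1) % 5 = 4 := by omega
    have h5 : k % 5 < 5 := Nat.mod_lt _ (by norm_num)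
    rw [Nat.mul_mod, Nat.add_mod] at h4
    interval_cases k % 5 <;> simp at h4
  rw [triangularTerm, show (2 * (k : ℤ⟦X⟧) + 1) * ((-1) ^ k * X ^ (k * (k + 1) / 2)) =
    C ((2 * (k : ℤ) + 1) * (-1) ^ k) * X ^ (k * (k + 1) / 2) by simp; ring,
    coeff_C_mul, coeff_X_pow,
    if_neg hne, mul_zero]

/-- The series `∑ f(N n + r) q^n`. -/
noncomputable def progression (N r : ℕ) : ℤ⟦X⟧ →+ ℤ⟦X⟧ where
  toFun f := mk fun n ↦ coeff (N * n + r) f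
  map_zero' := by ext; simp
  map_add' f g := by ext; simp

@[simp]
theorem coeff_progression (N r n : ℕ) (f : ℤ⟦X⟧) :
    coeff n (progression N r f) = coeff (N * n + r) f :=
  coeff_mk n fun n ↦ coeff (N * n + r) f

theorem progression_expand_mul {N r : ℕ} (hN : N ≠ 0) (hr : r < N) (f g : ℤ⟦X⟧) :
    progression N r (expand N hN g * f) = g * progression N r f := by
  ext n
  rw [coeff_progression, coeff_mul, coeff_mul]
  symm
  refine Finset.sum_of_injOn (fun p ↦ (N * p.1, N * p.2 + r)) ?_ ?_ ?_ ?_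
  · rintro ⟨a, b⟩ - ⟨c, d⟩ - h
    simpa [hN] using h
  · rintro ⟨a, b⟩ h
    rw [Finset.mem_coe, Finset.HasAntidiagonal.mem_antidiagonal] at h ⊢
    simp only at h ⊢
    subst h
    ring
  · rintro ⟨a, b⟩ h hne
    rw [Finset.HasAntidiagonal.mem_antidiagonal] at h
    simp only at h ⊢
    rw [coeff_expand_of_not_dvd, zero_mul]
    rintro ⟨c, rfl⟩
    have hc : c ≤ n := by
      by_contra! hc
      have : N * (n + 1) ≤ N * c := Nat.mul_le_mul_left _ hc
      rw [mul_add] at this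
      omega
    refine hne ⟨(c, n - c), ?_, ?_⟩
    · rw [Finset.mem_coe, Finset.HasAntidiagonal.mem_antidiagonal]
      exact Nat.add_sub_cancel' hc
    · have := Nat.mul_le_mul_left N hc
      simp only [Prod.mk.injEq, true_and, Nat.mul_sub]
      omega
  · rintro ⟨a, b⟩ -
    simp

theorem progression_progression (N M r s : ℕ) (f : ℤ⟦X⟧) :
    progression M s (progression N r f) = progression (N * M) (N * s + r) f := by
  ext n
  rw [coeff_progression, coeff_progression, coeff_progression,
    show N * (M * n + s) + r = N * M * n + (N * s + r) by ring]

/-- The substitution `q ↦ q^5`. -/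
noncomputable abbrev expandFive (R : Type*) [CommRing R] : R⟦X⟧ →ₐ[R] R⟦X⟧ :=
  expand 5 (by norm_num)

theorem coeff_X_pow_mul_expandFive {r : ℕ} (hr : r < 5) (f : ℤ⟦X⟧) (n : ℕ) :
    coeff n (X ^ r * expandFive ℤ f) = if n % 5 = r then coeff (n / 5) f else 0 := by
  rw [coeff_X_pow_mul', coeff_expand]
  split_ifs
  all_goals first | rfl | omega | skip
  congr 2
  omega

theorem sum_X_pow_mul_progression (f : ℤ⟦X⟧) :
    ∑ r ∈ Finset.range 5, X ^ r * expandFive ℤ (progression 5 r f) = f := by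
  ext n
  rw [map_sum, Finset.sum_congr rfl fun r hr ↦
    coeff_X_pow_mul_expandFive (Finset.mem_range.1 hr) _ _]
  simp [Nat.mod_lt, Nat.div_add_mod]

theorem progression_X_pow_mul {r s : ℕ} (hr : r < 5) (hs : s < 5) (f : ℤ⟦X⟧) :
    progression 5 s (X ^ r * expandFive ℤ f) = if r = s then f else 0 := by
  ext n
  rw [coeff_progression, coeff_X_pow_mul_expandFive hr, show (5 * n + s) % 5 = s by omega,
    show (5 * n + s) / 5 = n by omega]
  simp only [eq_comm (a := s)]
  split_ifs <;> simp

theorem pentagonal_five_mul_add_one (m : ℤ) :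
    pentagonal (5 * m + 1) = 5 * (5 * pentagonal (-m)) + 1 := by
  have h1 := two_mul_natCast_pentagonal (5 * m + 1)
  have h2 := two_mul_natCast_pentagonal_neg m
  zify
  linarith

theorem pentagonal_mod_five (k : ℤ) :
    pentagonal k % 5 ≤ 2 ∧ (pentagonal k % 5 = 1 → k % 5 = 1) := by
  have h := two_mul_natCast_pentagonal k
  obtain ⟨m, hm⟩ : ∃ m, k = 5 * m + k % 5 := ⟨k / 5, by omega⟩
  have h0 : 0 ≤ k % 5 := Int.emod_nonneg _ (by norm_num)
  have h5 : k % 5 < 5 := Int.emod_lt_of_pos _ (by norm_num)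
  generalize k % 5 = r at *
  subst hm
  have h' : 2 * (pentagonal (5 * m + r) : ℤ) =
      5 * (m * (15 * m + 6 * r - 1)) + r * (3 * r - 1) := by
    rw [h]
    ring
  generalize m * (15 * m + 6 * r - 1) = c at h'
  interval_cases r <;> omega

theorem progression_one_pentagonalSeries :
    progression 5 1 (pentagonalSeries ℤ) = -expandFive ℤ (pentagonalSeries ℤ) := by
  ext n
  rw [coeff_progression, map_neg]
  by_cases h : ∃ m, n = 5 * pentagonal (-m)
  · obtain ⟨m, rfl⟩ := h
    rw [coeff_expand_mul, ← pentagonal_five_mul_add_one, coeff_pentagonalSeries_pentagonal,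
      coeff_pentagonalSeries_pentagonal, Int.negOnePow_neg, Int.negOnePow_succ,
      (Int.negOnePow_eq_iff (5 * m) m).2 ⟨2 * m, by ring⟩]
    simp
  · rw [coeff_pentagonalSeries_eq_zero, coeff_expand]
    · split_ifs with h5
      · rw [coeff_pentagonalSeries_eq_zero, neg_zero]
        rintro ⟨k, hk⟩
        exact h ⟨-k, by rw [neg_neg]; omega⟩
      · rw [neg_zero]
    · rintro ⟨k, hk⟩
      have := (pentagonal_mod_five k).2 (by omega)
      obtain ⟨m, rfl⟩ : ∃ m, k = 5 * m + 1 := ⟨k / 5, by omega⟩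
      rw [pentagonal_five_mul_add_one] at hk
      exact h ⟨m, by omega⟩

theorem progression_pentagonalSeries_eq_zero {r : ℕ} (hr : r = 3 ∨ r = 4) :
    progression 5 r (pentagonalSeries ℤ) = 0 := by
  ext n
  rw [coeff_progression, coeff_pentagonalSeries_eq_zero, map_zero]
  rintro ⟨k, hk⟩
  have := (pentagonal_mod_five k).1
  omega

theorem pentagonalSeries_eq_dissection :
    pentagonalSeries ℤ = expandFive ℤ (progression 5 0 (pentagonalSeries ℤ)) -
      X * expandFive ℤ (expandFive ℤ (pentagonalSeries ℤ)) +
      X ^ 2 * expandFive ℤ (progression 5 2 (pentagonalSeries ℤ)) := by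
  conv_lhs => rw [← sum_X_pow_mul_progression (pentagonalSeries ℤ)]
  simp only [Finset.sum_range_succ, Finset.sum_range_zero, progression_one_pentagonalSeries,
    progression_pentagonalSeries_eq_zero (r := 3) (by simp),
    progression_pentagonalSeries_eq_zero (r := 4) (by simp), map_neg, map_zero, zero_add,
    pow_zero, pow_one, one_mul, mul_neg, mul_zero, add_zero, ← sub_eq_add_neg]

/-- The product of the conjugates `f(ω^j q)`, `0 ≤ j < 5`. -/
noncomputable def rescaleNorm (ω : ℂ) (f : ℂ⟦X⟧) : ℂ⟦X⟧ :=
  ∏ j ∈ Finset.range 5, rescale (ω ^ j) f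

theorem rescaleNorm_mul (ω : ℂ) (f g : ℂ⟦X⟧) :
    rescaleNorm ω (f * g) = rescaleNorm ω f * rescaleNorm ω g := by
  simp [rescaleNorm, Finset.prod_mul_distrib]

theorem rescale_pow_expandFive {ω : ℂ} (hω : ω ^ 5 = 1) (j : ℕ) (f : ℂ⟦X⟧) :
    rescale (ω ^ j) (expandFive ℂ f) = expandFive ℂ f := by
  ext n
  rw [coeff_rescale, coeff_expand]
  split_ifs with h
  · obtain ⟨m, rfl⟩ := h
    rw [← pow_mul, show j * (5 * m) = 5 * (j * m) by ring, pow_mul, hω, one_pow, one_mul]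
  · rw [mul_zero]

theorem rescaleNorm_one_sub_X_pow {ω : ℂ} (hω : IsPrimitiveRoot ω 5) (n : ℕ) :
    rescaleNorm ω (1 - X ^ n) = if 5 ∣ n then (1 - X ^ n) ^ 5 else 1 - X ^ (5 * n) := by
  have hj (j : ℕ) : rescale (ω ^ j) (1 - X ^ n : ℂ⟦X⟧) = 1 - C (ω ^ n) ^ j * X ^ n := by
    rw [map_sub, map_one, map_pow, rescale_X, mul_pow, ← map_pow, ← map_pow, ← pow_mul,
      ← pow_mul, mul_comm j]
  simp only [rescaleNorm, hj]
  split_ifs with h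
  · obtain ⟨m, rfl⟩ := h
    simp [pow_mul, hω.pow_eq_one]
  · have hprim : IsPrimitiveRoot (ω ^ n) 5 :=
      hω.pow_of_coprime n ((Nat.Prime.coprime_iff_not_dvd (by norm_num)).2 h).symm
    have hsum := congrArg (C (R := ℂ)) (hprim.geom_sum_eq_zero (by norm_num))
    simp only [Finset.sum_range_succ, Finset.prod_range_succ, Finset.sum_range_zero,
      Finset.prod_range_zero, map_add, map_pow, map_zero] at hsum ⊢
    rw [mul_comm 5 n, pow_mul]
    generalize C (ω ^ n) = w at *
    generalize (X : ℂ⟦X⟧) ^ n = x at *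
    grind

theorem rescaleNorm_trinomial {w a b c : ℂ⟦X⟧} (hw : 1 + w + w ^ 2 + w ^ 3 + w ^ 4 = 0)
    (h : a * c = -b ^ 2) :
    (a + b + c) * (a + w * b + w ^ 2 * c) * (a + w ^ 2 * b + w ^ 4 * c) *
      (a + w ^ 3 * b + w ^ 6 * c) * (a + w ^ 4 * b + w ^ 8 * c) = a ^ 5 + c ^ 5 + 11 * b ^ 5 := by
  grind

theorem rescaleNorm_eulerProd {ω : ℂ} (hω : IsPrimitiveRoot ω 5) (m : ℕ) :
    rescaleNorm ω (eulerProd ℂ (5 * m)) * expandFive ℂ (expandFive ℂ (eulerProd ℂ m)) =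
      expandFive ℂ (eulerProd ℂ (5 * m)) * expandFive ℂ (eulerProd ℂ m) ^ 5 := by
  induction m with
  | zero => simp [eulerProd, rescaleNorm]
  | succ m ih =>
    rw [show 5 * (m + 1) = 5 * m + 1 + 1 + 1 + 1 + 1 by ring]
    simp only [eulerProd_succ, rescaleNorm_mul, rescaleNorm_one_sub_X_pow hω, map_mul, map_sub,
      map_one, map_pow, expand_X]
    rw [if_neg (by omega), if_neg (by omega), if_neg (by omega), if_neg (by omega),
      if_pos (by omega)]
    simp only [← pow_mul]
    rw [show 5 * m + 1 + 1 + 1 + 1 + 1 = 5 * (m + 1) by ring, ← mul_assoc 5 5 (m + 1)]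
    linear_combination (1 - X ^ (5 * (5 * m + 1))) * (1 - X ^ (5 * (5 * m + 1 + 1))) *
      (1 - X ^ (5 * (5 * m + 1 + 1 + 1))) * (1 - X ^ (5 * (5 * m + 1 + 1 + 1 + 1))) *
      (1 - X ^ (5 * (m + 1))) ^ 5 * (1 - X ^ (5 * 5 * (m + 1))) * ih

theorem modXPow_rescale {R : Type*} [CommRing R] {M : ℕ} {f g : R⟦X⟧} (a : R)
    (h : modXPow R M f = modXPow R M g) :
    modXPow R M (rescale a f) = modXPow R M (rescale a g) := by
  rw [modXPow_eq_iff] at h ⊢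
  intro m hm
  rw [coeff_rescale, coeff_rescale, h m hm]

theorem modXPow_expandFive {R : Type*} [CommRing R] {M : ℕ} {f g : R⟦X⟧}
    (h : modXPow R M f = modXPow R M g) :
    modXPow R M (expandFive R f) = modXPow R M (expandFive R g) := by
  rw [modXPow_eq_iff] at h ⊢
  intro m hm
  rw [coeff_expand, coeff_expand, h _ ((Nat.div_le_self _ _).trans_lt hm)]

theorem rescaleNorm_pentagonalSeries {ω : ℂ} (hω : IsPrimitiveRoot ω 5) :
    rescaleNorm ω (pentagonalSeries ℂ) * expandFive ℂ (expandFive ℂ (pentagonalSeries ℂ)) =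
      expandFive ℂ (pentagonalSeries ℂ) ^ 6 := by
  refine eq_of_modXPow_eq fun M ↦ ?_
  have h1 : modXPow ℂ M (eulerProd ℂ M) = modXPow ℂ M (pentagonalSeries ℂ) :=
    modXPow_eulerProd le_rfl
  have h5 : modXPow ℂ M (eulerProd ℂ (5 * M)) = modXPow ℂ M (pentagonalSeries ℂ) :=
    modXPow_eulerProd (by omega)
  have h := congrArg (modXPow ℂ M) (rescaleNorm_eulerProd hω M)
  simp only [rescaleNorm, map_mul, map_pow, map_prod] at h ⊢
  rw [modXPow_expandFive h5, modXPow_expandFive h1, modXPow_expandFive (modXPow_expandFive h1),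
    Finset.prod_congr rfl fun j _ ↦ modXPow_rescale (ω ^ j) h5] at h
  rw [h]
  ring

theorem map_pentagonalSeries :
    map (Int.castRingHom ℂ) (pentagonalSeries ℤ) = pentagonalSeries ℂ := by
  ext n
  rw [coeff_map]
  by_cases h : n ∈ Set.range pentagonal
  · obtain ⟨k, rfl⟩ := h
    simp
  · simp [coeff_pentagonalSeries_eq_zero _ h]

theorem progression_zero_dissection (f₀ f₁ f₂ f₃ f₄ : ℤ⟦X⟧) :
    progression 5 0 (expandFive ℤ f₀ + X * expandFive ℤ f₁ + X ^ 2 * expandFive ℤ f₂ +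
      X ^ 3 * expandFive ℤ f₃ + X ^ 4 * expandFive ℤ f₄) = f₀ := by
  have h0 := progression_X_pow_mul (r := 0) (s := 0) (by norm_num) (by norm_num) f₀
  have h1 := progression_X_pow_mul (r := 1) (s := 0) (by norm_num) (by norm_num) f₁
  rw [pow_zero, one_mul] at h0
  rw [pow_one] at h1
  simp [h0, h1, progression_X_pow_mul]

theorem progression_two_dissection (f₀ f₁ f₂ f₃ f₄ : ℤ⟦X⟧) :
    progression 5 2 (expandFive ℤ f₀ + X * expandFive ℤ f₁ + X ^ 2 * expandFive ℤ f₂ +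
      X ^ 3 * expandFive ℤ f₃ + X ^ 4 * expandFive ℤ f₄) = f₂ := by
  have h0 := progression_X_pow_mul (r := 0) (s := 2) (by norm_num) (by norm_num) f₀
  have h1 := progression_X_pow_mul (r := 1) (s := 2) (by norm_num) (by norm_num) f₁
  rw [pow_zero, one_mul] at h0
  rw [pow_one] at h1
  simp [h0, h1, progression_X_pow_mul]

theorem progression_zero_mul_progression_two :
    progression 5 0 (pentagonalSeries ℤ) * progression 5 2 (pentagonalSeries ℤ) =
      -expandFive ℤ (pentagonalSeries ℤ) ^ 2 := by
  have hE := pentagonalSeries_eq_dissection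
  have h0 : progression 5 0 (pentagonalSeries ℤ) ≠ 0 := by
    intro h
    have := congrArg (coeff 0) h
    rw [coeff_progression, mul_zero, zero_add, show 0 = pentagonal 0 from rfl,
      coeff_pentagonalSeries_pentagonal] at this
    simp at this
  have h : progression 5 2 (pentagonalSeries ℤ ^ 3) = 0 := by
    ext n
    rw [coeff_progression, coeff_pentagonalSeries_pow_three (by omega), map_zero]
  generalize progression 5 0 (pentagonalSeries ℤ) = a at *
  generalize progression 5 2 (pentagonalSeries ℤ) = c at *
  generalize expandFive ℤ (pentagonalSeries ℤ) = e at *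
  have hcube : pentagonalSeries ℤ ^ 3 =
      expandFive ℤ (a ^ 3 - 3 * X * e * c ^ 2) + X * expandFive ℤ (-3 * a ^ 2 * e + X * c ^ 3) +
      X ^ 2 * expandFive ℤ (3 * a * (a * c + e ^ 2)) +
      X ^ 3 * expandFive ℤ (-6 * a * e * c - e ^ 3) +
      X ^ 4 * expandFive ℤ (3 * a * c ^ 2 + 3 * e ^ 2 * c) := by
    rw [hE]
    simp only [map_add, map_sub, map_mul, map_pow, map_neg, map_ofNat, expand_X]
    ring
  rw [hcube, progression_two_dissection] at h
  have : a * c + e ^ 2 = 0 := by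
    rcases mul_eq_zero.1 h with h | h
    · exact absurd h (mul_ne_zero (fun h3 ↦ by
        have h3 := congrArg (coeff (R := ℤ) 0) h3
        rw [← map_ofNat (C (R := ℤ)), coeff_zero_C] at h3
        norm_num at h3) h0)
    · exact h
  linear_combination this

theorem progression_X_pow_mul_pentagonalSeries_pow :
    progression 5 0 (X ^ 4 * pentagonalSeries ℤ) = -X * expandFive ℤ (pentagonalSeries ℤ) ∧
    progression 5 0 (X ^ 3 * pentagonalSeries ℤ ^ 2) =
      -X * expandFive ℤ (pentagonalSeries ℤ) ^ 2 ∧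
    progression 5 0 (X ^ 2 * pentagonalSeries ℤ ^ 3) =
      5 * X * expandFive ℤ (pentagonalSeries ℤ) ^ 3 ∧
    progression 5 0 (X * pentagonalSeries ℤ ^ 4) =
      -5 * X * expandFive ℤ (pentagonalSeries ℤ) ^ 4 := by
  have hE := pentagonalSeries_eq_dissection
  have hac := progression_zero_mul_progression_two
  generalize progression 5 0 (pentagonalSeries ℤ) = a at *
  generalize progression 5 2 (pentagonalSeries ℤ) = c at *
  generalize expandFive ℤ (pentagonalSeries ℤ) = e at *
  have h1 : X ^ 4 * pentagonalSeries ℤ =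
      expandFive ℤ (-X * e) + X * expandFive ℤ (X * c) + X ^ 2 * expandFive ℤ 0 +
      X ^ 3 * expandFive ℤ 0 + X ^ 4 * expandFive ℤ a := by
    rw [hE]
    simp only [map_mul, map_neg, map_zero, expand_X]
    ring
  have h2 : X ^ 3 * pentagonalSeries ℤ ^ 2 =
      expandFive ℤ (X * (e ^ 2 + 2 * (a * c))) + X * expandFive ℤ (-2 * X * e * c) +
      X ^ 2 * expandFive ℤ (X * c ^ 2) + X ^ 3 * expandFive ℤ (a ^ 2) +
      X ^ 4 * expandFive ℤ (-2 * a * e) := by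
    rw [hE]
    simp only [map_add, map_mul, map_pow, map_neg, map_ofNat, expand_X]
    ring
  have h3 : X ^ 2 * pentagonalSeries ℤ ^ 3 =
      expandFive ℤ (X * (-6 * (a * c) * e - e ^ 3)) +
      X * expandFive ℤ (X * (3 * a * c ^ 2 + 3 * e ^ 2 * c)) +
      X ^ 2 * expandFive ℤ (a ^ 3 - 3 * X * e * c ^ 2) +
      X ^ 3 * expandFive ℤ (-3 * a ^ 2 * e + X * c ^ 3) +
      X ^ 4 * expandFive ℤ (3 * a ^ 2 * c + 3 * a * e ^ 2) := by
    rw [hE]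
    simp only [map_add, map_sub, map_mul, map_pow, map_neg, map_ofNat, expand_X]
    ring
  have h4 : X * pentagonalSeries ℤ ^ 4 =
      expandFive ℤ (X * (e ^ 4 + 12 * (a * c) * e ^ 2 + 6 * (a * c) ^ 2)) +
      X * expandFive ℤ (a ^ 4 + X * (-12 * a * e * c ^ 2 - 4 * e ^ 3 * c)) +
      X ^ 2 * expandFive ℤ (-4 * a ^ 3 * e + X * (4 * a * c ^ 3 + 6 * e ^ 2 * c ^ 2)) +
      X ^ 3 * expandFive ℤ (4 * a ^ 3 * c + 6 * a ^ 2 * e ^ 2 - 4 * X * e * c ^ 3) +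
      X ^ 4 * expandFive ℤ (-12 * a ^ 2 * e * c - 4 * a * e ^ 3 + X * c ^ 4) := by
    rw [hE]
    simp only [map_add, map_sub, map_mul, map_pow, map_neg, map_ofNat, expand_X]
    ring
  rw [h1, h2, h3, h4]
  simp only [progression_zero_dissection, hac]
  refine ⟨trivial, ?_, ?_, ?_⟩ <;> ring

/-- The modular equation of degree five satisfied by the Euler product. -/
theorem expandFive_pentagonalSeries_pow_six :
    expandFive ℤ (pentagonalSeries ℤ) ^ 6 =
      expandFive ℤ (expandFive ℤ (pentagonalSeries ℤ)) *
        (expandFive ℤ (progression 5 0 (pentagonalSeries ℤ)) ^ 5 +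
          (X ^ 2 * expandFive ℤ (progression 5 2 (pentagonalSeries ℤ))) ^ 5 -
          11 * (X * expandFive ℤ (expandFive ℤ (pentagonalSeries ℤ))) ^ 5) := by
  apply map_injective (Int.castRingHom ℂ) Int.cast_injective
  have hω := Complex.isPrimitiveRoot_exp 5 (by norm_num)
  generalize Complex.exp (2 * Real.pi * Complex.I / (5 : ℕ)) = ω at hω
  have hw := congrArg (C (R := ℂ)) (hω.geom_sum_eq_zero (by norm_num))
  have hE := congrArg (map (Int.castRingHom ℂ)) pentagonalSeries_eq_dissection
  have hac := congrArg (fun f ↦ map (Int.castRingHom ℂ) (expandFive ℤ f))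
    progression_zero_mul_progression_two
  have hnorm := rescaleNorm_pentagonalSeries hω
  have hres (j : ℕ) (f : ℂ⟦X⟧) := rescale_pow_expandFive hω.pow_eq_one j f
  simp only [map_add, map_sub, map_mul, map_pow, map_neg, map_ofNat, map_X, map_expand,
    map_pentagonalSeries] at hE hac ⊢
  rw [← hnorm]
  have key (j : ℕ) : rescale (ω ^ j) (pentagonalSeries ℂ) =
      expandFive ℂ (map (Int.castRingHom ℂ) (progression 5 0 (pentagonalSeries ℤ))) +
      C ω ^ j * (-(X * expandFive ℂ (expandFive ℂ (pentagonalSeries ℂ)))) +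
      C ω ^ (2 * j) *
        (X ^ 2 * expandFive ℂ (map (Int.castRingHom ℂ) (progression 5 2 (pentagonalSeries ℤ)))) := by
    conv_lhs => rw [hE]
    simp only [map_add, map_sub, map_mul, map_pow, hres, rescale_X]
    ring
  simp only [rescaleNorm, key, Finset.prod_range_succ, Finset.prod_range_zero]
  simp only [Finset.sum_range_succ, Finset.sum_range_zero, map_add, map_pow, map_zero,
    pow_zero, pow_one, zero_add, map_one] at hw
  generalize expandFive ℂ (map (Int.castRingHom ℂ) (progression 5 0 (pentagonalSeries ℤ))) = a at *
  generalize expandFive ℂ (map (Int.castRingHom ℂ) (progression 5 2 (pentagonalSeries ℤ))) = c at *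
  have := rescaleNorm_trinomial (a := a) (c := X ^ 2 * c)
    (b := -(X * expandFive ℂ (expandFive ℂ (pentagonalSeries ℂ)))) hw
    (by linear_combination X ^ 2 * hac)
  linear_combination expandFive ℂ (expandFive ℂ (pentagonalSeries ℂ)) * this

/-- The series `q E(q^25) / E(q)`, where `E` is the Euler product. -/
noncomputable def ramanujanZ : ℤ⟦X⟧ :=
  X * expandFive ℤ (expandFive ℤ (pentagonalSeries ℤ)) * partitionSeries

/-- The Hauptmodul `q E(q^5)^6 / E(q)^6`, where `E` is the Euler product. -/
noncomputable def hauptmodulFive : ℤ⟦X⟧ :=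
  X * expandFive ℤ (pentagonalSeries ℤ) ^ 6 * partitionSeries ^ 6

theorem pentagonalSeries_quintic :
    (X * expandFive ℤ (expandFive ℤ (pentagonalSeries ℤ))) ^ 5 =
      expandFive ℤ hauptmodulFive * (pentagonalSeries ℤ ^ 5 +
        5 * pentagonalSeries ℤ ^ 4 * (X * expandFive ℤ (expandFive ℤ (pentagonalSeries ℤ))) +
        15 * pentagonalSeries ℤ ^ 3 * (X * expandFive ℤ (expandFive ℤ (pentagonalSeries ℤ))) ^ 2 +
        25 * pentagonalSeries ℤ ^ 2 * (X * expandFive ℤ (expandFive ℤ (pentagonalSeries ℤ))) ^ 3 +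
        25 * pentagonalSeries ℤ * (X * expandFive ℤ (expandFive ℤ (pentagonalSeries ℤ))) ^ 4) := by
  have hE := pentagonalSeries_eq_dissection
  have hac := congrArg (expandFive ℤ) progression_zero_mul_progression_two
  have hN := expandFive_pentagonalSeries_pow_six
  have hP := congrArg (expandFive ℤ) pentagonalSeries_mul_partitionSeries
  simp only [hauptmodulFive, map_mul, map_pow, map_neg, map_one, expand_X] at hac hP ⊢
  set F := expandFive ℤ (expandFive ℤ (pentagonalSeries ℤ))
  set A := expandFive ℤ (progression 5 0 (pentagonalSeries ℤ))
  set B := expandFive ℤ (progression 5 2 (pentagonalSeries ℤ))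
  have hpoly : pentagonalSeries ℤ ^ 5 + 5 * pentagonalSeries ℤ ^ 4 * (X * F) +
      15 * pentagonalSeries ℤ ^ 3 * (X * F) ^ 2 + 25 * pentagonalSeries ℤ ^ 2 * (X * F) ^ 3 +
      25 * pentagonalSeries ℤ * (X * F) ^ 4 = A ^ 5 + (X ^ 2 * B) ^ 5 - 11 * (X * F) ^ 5 := by
    have hAC : A * (X ^ 2 * B) = -(X * F) ^ 2 := by linear_combination X ^ 2 * hac
    rw [hE]
    generalize X ^ 2 * B = c at *
    generalize X * F = y at *
    clear_value A
    clear hE hN hP hac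
    grind
  have hP6 : expandFive ℤ (pentagonalSeries ℤ) ^ 6 * expandFive ℤ partitionSeries ^ 6 = 1 := by
    rw [← mul_pow, hP, one_pow]
  rw [hpoly]
  linear_combination -(X * F) ^ 5 * hP6 + X ^ 5 * F ^ 5 * expandFive ℤ partitionSeries ^ 6 * hN

theorem ramanujanZ_pow_add_five (i : ℕ) :
    ramanujanZ ^ (i + 5) =
      expandFive ℤ hauptmodulFive * ramanujanZ ^ i +
      expandFive ℤ (5 * hauptmodulFive) * ramanujanZ ^ (i + 1) +
      expandFive ℤ (15 * hauptmodulFive) * ramanujanZ ^ (i + 2) +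
      expandFive ℤ (25 * hauptmodulFive) * ramanujanZ ^ (i + 3) +
      expandFive ℤ (25 * hauptmodulFive) * ramanujanZ ^ (i + 4) := by
  have h := pentagonalSeries_quintic
  have hP := pentagonalSeries_mul_partitionSeries
  simp only [map_mul, map_ofNat]
  generalize expandFive ℤ hauptmodulFive = t at *
  rw [ramanujanZ]
  generalize X * expandFive ℤ (expandFive ℤ (pentagonalSeries ℤ)) = y at *
  have h2 : pentagonalSeries ℤ ^ 2 * partitionSeries ^ 2 = 1 := by rw [← mul_pow, hP, one_pow]
  have h3 : pentagonalSeries ℤ ^ 3 * partitionSeries ^ 3 = 1 := by rw [← mul_pow, hP, one_pow]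
  have h4 : pentagonalSeries ℤ ^ 4 * partitionSeries ^ 4 = 1 := by rw [← mul_pow, hP, one_pow]
  have h5 : pentagonalSeries ℤ ^ 5 * partitionSeries ^ 5 = 1 := by rw [← mul_pow, hP, one_pow]
  linear_combination (y * partitionSeries) ^ i * (partitionSeries ^ 5 * h + t * h5 +
    5 * t * y * partitionSeries * h4 + 15 * t * y ^ 2 * partitionSeries ^ 2 * h3 +
    25 * t * y ^ 3 * partitionSeries ^ 3 * h2 + 25 * t * y ^ 4 * partitionSeries ^ 4 * hP)

theorem progression_one_zero : progression 5 0 1 = 1 := by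
  have := progression_zero_dissection 1 0 0 0 0
  simpa using this

theorem expandFive_pentagonalSeries_ne_zero : expandFive ℤ (pentagonalSeries ℤ) ≠ 0 := by
  intro h
  have := congrArg (expandFive ℤ) pentagonalSeries_mul_partitionSeries
  rw [map_mul, h, zero_mul, map_one] at this
  exact zero_ne_one this

theorem progression_ramanujanZ_pow :
    progression 5 0 ramanujanZ = 5 * hauptmodulFive ∧
    progression 5 0 (ramanujanZ ^ 2) = 10 * hauptmodulFive + 125 * hauptmodulFive ^ 2 ∧
    progression 5 0 (ramanujanZ ^ 3) =
      9 * hauptmodulFive + 375 * hauptmodulFive ^ 2 + 3125 * hauptmodulFive ^ 3 ∧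
    progression 5 0 (ramanujanZ ^ 4) = 4 * hauptmodulFive + 550 * hauptmodulFive ^ 2 +
      12500 * hauptmodulFive ^ 3 + 78125 * hauptmodulFive ^ 4 := by
  obtain ⟨m1, m2, m3, m4⟩ := progression_X_pow_mul_pentagonalSeries_pow
  have hY := pentagonalSeries_quintic
  have hP := pentagonalSeries_mul_partitionSeries
  have h2 : pentagonalSeries ℤ ^ 2 * partitionSeries ^ 2 = 1 := by rw [← mul_pow, hP, one_pow]
  have h3 : pentagonalSeries ℤ ^ 3 * partitionSeries ^ 3 = 1 := by rw [← mul_pow, hP, one_pow]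
  have h4 : pentagonalSeries ℤ ^ 4 * partitionSeries ^ 4 = 1 := by rw [← mul_pow, hP, one_pow]
  have hne (k : ℕ) : X * expandFive ℤ (pentagonalSeries ℤ) ^ k ≠ 0 :=
    mul_ne_zero X_ne_zero (pow_ne_zero _ expandFive_pentagonalSeries_ne_zero)
  have hz : ramanujanZ =
    X * expandFive ℤ (expandFive ℤ (pentagonalSeries ℤ)) * partitionSeries := rfl
  generalize hauptmodulFive = u at *
  generalize ramanujanZ = z at *
  generalize expandFive ℤ (pentagonalSeries ℤ) = e at *
  have hprog (f g : ℤ⟦X⟧) : progression 5 0 (expandFive ℤ g * f) = g * progression 5 0 f :=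
    progression_expand_mul _ (by norm_num) f g
  have i1 : expandFive ℤ (X * e ^ 4) * z =
      expandFive ℤ u * (X * pentagonalSeries ℤ ^ 4) +
      expandFive ℤ (5 * u * e) * (X ^ 2 * pentagonalSeries ℤ ^ 3) +
      expandFive ℤ (15 * u * e ^ 2) * (X ^ 3 * pentagonalSeries ℤ ^ 2) +
      expandFive ℤ (25 * u * e ^ 3) * (X ^ 4 * pentagonalSeries ℤ) +
      expandFive ℤ (25 * X * u * e ^ 4) * 1 := by
    simp only [map_mul, map_pow, map_ofNat, expand_X, hz]
    generalize expandFive ℤ u = t at *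
    generalize expandFive ℤ e = F at *
    linear_combination X * partitionSeries * hY + t * (X * pentagonalSeries ℤ ^ 4 +
      5 * F * X ^ 2 * pentagonalSeries ℤ ^ 3 + 15 * F ^ 2 * X ^ 3 * pentagonalSeries ℤ ^ 2 +
      25 * F ^ 3 * X ^ 4 * pentagonalSeries ℤ + 25 * F ^ 4 * X ^ 5) * hP
  have i2 : expandFive ℤ (X * e ^ 3) * z ^ 2 =
      expandFive ℤ u * (X ^ 2 * pentagonalSeries ℤ ^ 3) +
      expandFive ℤ (5 * u * e) * (X ^ 3 * pentagonalSeries ℤ ^ 2) +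
      expandFive ℤ (15 * u * e ^ 2) * (X ^ 4 * pentagonalSeries ℤ) +
      expandFive ℤ (25 * X * u * e ^ 3) * 1 + expandFive ℤ (25 * X * u * e ^ 3) * z := by
    simp only [map_mul, map_pow, map_ofNat, expand_X, hz]
    generalize expandFive ℤ u = t at *
    generalize expandFive ℤ e = F at *
    linear_combination X ^ 2 * partitionSeries ^ 2 * hY + t * (X ^ 2 * pentagonalSeries ℤ ^ 3 +
      5 * F * X ^ 3 * pentagonalSeries ℤ ^ 2 + 15 * F ^ 2 * X ^ 4 * pentagonalSeries ℤ +
      25 * F ^ 3 * X ^ 5) * h2 + 25 * t * F ^ 4 * X ^ 6 * partitionSeries * hP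
  have i3 : expandFive ℤ (X * e ^ 2) * z ^ 3 =
      expandFive ℤ u * (X ^ 3 * pentagonalSeries ℤ ^ 2) +
      expandFive ℤ (5 * u * e) * (X ^ 4 * pentagonalSeries ℤ) +
      expandFive ℤ (15 * X * u * e ^ 2) * 1 + expandFive ℤ (25 * X * u * e ^ 2) * z +
      expandFive ℤ (25 * X * u * e ^ 2) * z ^ 2 := by
    simp only [map_mul, map_pow, map_ofNat, expand_X, hz]
    generalize expandFive ℤ u = t at *
    generalize expandFive ℤ e = F at *
    linear_combination X ^ 3 * partitionSeries ^ 3 * hY + t * (X ^ 3 * pentagonalSeries ℤ ^ 2 +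
      5 * F * X ^ 4 * pentagonalSeries ℤ + 15 * F ^ 2 * X ^ 5) * h3 +
      25 * t * F ^ 3 * X ^ 6 * partitionSeries * h2 +
      25 * t * F ^ 4 * X ^ 7 * partitionSeries ^ 2 * hP
  have i4 : expandFive ℤ (X * e ^ 1) * z ^ 4 =
      expandFive ℤ u * (X ^ 4 * pentagonalSeries ℤ) + expandFive ℤ (5 * X * u * e) * 1 +
      expandFive ℤ (15 * X * u * e) * z + expandFive ℤ (25 * X * u * e) * z ^ 2 +
      expandFive ℤ (25 * X * u * e) * z ^ 3 := by
    simp only [map_mul, map_pow, map_ofNat, expand_X, hz]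
    generalize expandFive ℤ u = t at *
    generalize expandFive ℤ e = F at *
    linear_combination X ^ 4 * partitionSeries ^ 4 * hY + t * (X ^ 4 * pentagonalSeries ℤ +
      5 * F * X ^ 5) * h4 + 15 * t * F ^ 2 * X ^ 6 * partitionSeries * h3 +
      25 * t * F ^ 3 * X ^ 7 * partitionSeries ^ 2 * h2 +
      25 * t * F ^ 4 * X ^ 8 * partitionSeries ^ 3 * hP
  replace i1 := congrArg (progression 5 0) i1
  replace i2 := congrArg (progression 5 0) i2
  replace i3 := congrArg (progression 5 0) i3
  replace i4 := congrArg (progression 5 0) i4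
  simp only [map_add, hprog, m1, m2, m3, m4, progression_one_zero] at i1 i2 i3 i4
  have r1 : progression 5 0 z = 5 * u := mul_left_cancel₀ (hne 4) (by linear_combination i1)
  rw [r1] at i2 i3 i4
  have r2 : progression 5 0 (z ^ 2) = 10 * u + 125 * u ^ 2 :=
    mul_left_cancel₀ (hne 3) (by linear_combination i2)
  rw [r2] at i3 i4
  have r3 : progression 5 0 (z ^ 3) = 9 * u + 375 * u ^ 2 + 3125 * u ^ 3 :=
    mul_left_cancel₀ (hne 2) (by linear_combination i3)
  rw [r3] at i4
  exact ⟨r1, r2, r3, mul_left_cancel₀ (hne 1) (by linear_combination i4)⟩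

/-- The integral combinations of the powers `u ^ k`, `k ≥ m`, of the Hauptmodul `u` in which the
coefficient of `u ^ k` is divisible by `5 ^ v k`. -/
noncomputable def adicSpan (v : ℕ → ℕ) (m : ℕ) : AddSubgroup ℤ⟦X⟧ :=
  AddSubgroup.closure
    {f | ∃ k, ∃ c : ℤ, m ≤ k ∧ 5 ^ v k ∣ c ∧ f = C c * hauptmodulFive ^ k}

theorem C_mul_pow_mem_adicSpan {v : ℕ → ℕ} {m k : ℕ} {c : ℤ} (hk : m ≤ k) (hc : 5 ^ v k ∣ c) :
    C c * hauptmodulFive ^ k ∈ adicSpan v m :=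
  AddSubgroup.subset_closure ⟨k, c, hk, hc, rfl⟩

theorem map_mem_of_mem_adicSpan {v : ℕ → ℕ} {m : ℕ} (F : ℤ⟦X⟧ →+ ℤ⟦X⟧) (S : AddSubgroup ℤ⟦X⟧)
    (h : ∀ k, ∀ c : ℤ, m ≤ k → 5 ^ v k ∣ c → F (C c * hauptmodulFive ^ k) ∈ S)
    {f : ℤ⟦X⟧} (hf : f ∈ adicSpan v m) : F f ∈ S := by
  suffices adicSpan v m ≤ S.comap F from this hf
  rw [adicSpan, AddSubgroup.closure_le]
  rintro _ ⟨k, c, hk, hc, rfl⟩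
  exact h k c hk hc

theorem C_mul_pow_mul_mem_adicSpan {v w : ℕ → ℕ} {m n e i : ℕ} {c : ℤ} (hc : 5 ^ e ∣ c)
    (hn : n ≤ m + i) (h : ∀ k, m ≤ k → w (k + i) ≤ v k + e) {f : ℤ⟦X⟧} (hf : f ∈ adicSpan v m) :
    C c * hauptmodulFive ^ i * f ∈ adicSpan w n := by
  refine map_mem_of_mem_adicSpan (AddMonoidHom.mulLeft (C c * hauptmodulFive ^ i)) _
    (fun k d hk hd ↦ ?_) hf
  rw [AddMonoidHom.coe_mulLeft, show C c * hauptmodulFive ^ i * (C d * hauptmodulFive ^ k) =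
    C (d * c) * hauptmodulFive ^ (k + i) by rw [map_mul]; ring]
  refine C_mul_pow_mem_adicSpan (by omega) ((pow_dvd_pow 5 (h k hk)).trans ?_)
  rw [pow_add]
  exact mul_dvd_mul hd hc

theorem C_mul_mem_adicSpan {v w : ℕ → ℕ} {m n e : ℕ} {c : ℤ} (hc : 5 ^ e ∣ c)
    (hn : n ≤ m) (h : ∀ k, m ≤ k → w k ≤ v k + e) {f : ℤ⟦X⟧} (hf : f ∈ adicSpan v m) :
    C c * f ∈ adicSpan w n := by
  simpa using C_mul_pow_mul_mem_adicSpan (i := 0) hc hn h hf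

theorem adicSpan_mono {v w : ℕ → ℕ} {m n : ℕ} (hn : n ≤ m) (h : ∀ k, m ≤ k → w k ≤ v k) :
    adicSpan v m ≤ adicSpan w n := fun f hf ↦ by
  simpa using C_mul_mem_adicSpan (e := 0) (c := 1) (by simp) hn h hf

theorem exists_pow_mul_eq_of_mem_adicSpan {v : ℕ → ℕ} {m i : ℕ} (hi : i ≤ m) {f : ℤ⟦X⟧}
    (hf : f ∈ adicSpan v m) :
    ∃ g ∈ adicSpan (fun j ↦ v (i + j)) (m - i), hauptmodulFive ^ i * g = f := by
  have := map_mem_of_mem_adicSpan (AddMonoidHom.id _)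
    ((adicSpan (fun j ↦ v (i + j)) (m - i)).map (AddMonoidHom.mulLeft (hauptmodulFive ^ i)))
    (fun k c hk hc ↦ ?_) hf
  · simpa using this
  · obtain ⟨j, rfl⟩ := Nat.exists_eq_add_of_le (hi.trans hk)
    exact ⟨C c * hauptmodulFive ^ j, C_mul_pow_mem_adicSpan (by omega) hc, by
      simp only [AddMonoidHom.coe_mulLeft, AddMonoidHom.id_apply]; ring⟩

theorem dvd_coeff_mul_of_mem_adicSpan {v : ℕ → ℕ} {m e : ℕ} (h : ∀ k, m ≤ k → e ≤ v k)
    {f : ℤ⟦X⟧} (hf : f ∈ adicSpan v m) (g : ℤ⟦X⟧) (n : ℕ) : (5 : ℤ) ^ e ∣ coeff n (g * f) := by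
  rw [← Int.mem_zmultiples_iff]
  have := map_mem_of_mem_adicSpan (AddMonoidHom.mulLeft g)
    ((AddSubgroup.zmultiples ((5 : ℤ) ^ e)).comap (coeff (R := ℤ) n).toAddMonoidHom)
    (fun k c hk hc ↦ ?_) hf
  · simpa using this
  · simp only [AddSubgroup.mem_comap, AddMonoidHom.coe_mulLeft, LinearMap.toAddMonoidHom_coe,
      Int.mem_zmultiples_iff]
    rw [mul_left_comm, coeff_C_mul]
    exact ((pow_dvd_pow 5 (h k hk)).trans hc).mul_right _

theorem progression_expandFive_mul {r : ℕ} (hr : r < 5) (f g : ℤ⟦X⟧) :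
    progression 5 r (expandFive ℤ g * f) = g * progression 5 r f :=
  progression_expand_mul _ hr f g

theorem progression_C_mul (c : ℤ) (f : ℤ⟦X⟧) :
    progression 5 0 (C c * f) = C c * progression 5 0 f := by
  ext n
  simp only [coeff_progression, coeff_C_mul]

theorem progression_ramanujanZ_pow_mem (i : ℕ) :
    progression 5 0 (ramanujanZ ^ i) ∈
      adicSpan (fun k ↦ (5 * k - i - 1) / 2) ((i + 4) / 5) := by
  have term (k : ℕ) (c : ℤ) : ∀ i, (i + 4) / 5 ≤ k → 5 ^ ((5 * k - i - 1) / 2) ∣ c →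
      C c * hauptmodulFive ^ k ∈ adicSpan (fun k ↦ (5 * k - i - 1) / 2) ((i + 4) / 5) :=
    fun i hk hc ↦ C_mul_pow_mem_adicSpan hk hc
  obtain ⟨h1, h2, h3, h4⟩ := progression_ramanujanZ_pow
  induction i using Nat.strong_induction_on with
  | _ i ih =>
    match i with
    | 0 =>
      rw [pow_zero, progression_one_zero]
      simpa using term 0 1 0 (by norm_num) (by norm_num)
    | 1 =>
      rw [pow_one, h1]
      simpa using term 1 5 1 (by norm_num) (by norm_num)
    | 2 =>
      rw [h2]
      simpa using add_mem (term 1 10 2 (by norm_num) (by norm_num))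
        (term 2 125 2 (by norm_num) (by norm_num))
    | 3 =>
      rw [h3]
      simpa using add_mem (add_mem (term 1 9 3 (by norm_num) (by norm_num))
        (term 2 375 3 (by norm_num) (by norm_num))) (term 3 3125 3 (by norm_num) (by norm_num))
    | 4 =>
      rw [h4]
      simpa using add_mem (add_mem (add_mem (term 1 4 4 (by norm_num) (by norm_num))
        (term 2 550 4 (by norm_num) (by norm_num))) (term 3 12500 4 (by norm_num) (by norm_num)))
        (term 4 78125 4 (by norm_num) (by norm_num))
    | i + 5 =>
      rw [ramanujanZ_pow_add_five]
      simp only [map_add, progression_expandFive_mul (show 0 < 5 by norm_num)]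
      have step (j e : ℕ) (c : ℤ) (hj : j < 5) (hc : 5 ^ e ∣ c) (he : j ≤ 2 * e) :
          C c * hauptmodulFive ^ 1 * progression 5 0 (ramanujanZ ^ (i + j)) ∈
            adicSpan (fun k ↦ (5 * k - (i + 5) - 1) / 2) ((i + 5 + 4) / 5) :=
        C_mul_pow_mul_mem_adicSpan hc (by omega) (fun k hk ↦ by omega) (ih (i + j) (by omega))
      simpa using add_mem (add_mem (add_mem (add_mem
        (step 0 0 1 (by norm_num) (by norm_num) (by norm_num))
        (step 1 1 5 (by norm_num) (by norm_num) (by norm_num)))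
        (step 2 1 15 (by norm_num) (by norm_num) (by norm_num)))
        (step 3 2 25 (by norm_num) (by norm_num) (by norm_num)))
        (step 4 2 25 (by norm_num) (by norm_num) (by norm_num))

theorem expandFive_hauptmodulFive_mul :
    expandFive ℤ hauptmodulFive * hauptmodulFive = ramanujanZ ^ 6 := by
  have hP : expandFive ℤ (pentagonalSeries ℤ) ^ 6 * expandFive ℤ partitionSeries ^ 6 = 1 := by
    rw [← mul_pow, ← map_mul, pentagonalSeries_mul_partitionSeries, map_one, one_pow]
  simp only [ramanujanZ, hauptmodulFive, map_mul, map_pow, expand_X]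
  linear_combination X ^ 6 * expandFive ℤ (expandFive ℤ (pentagonalSeries ℤ)) ^ 6 *
    partitionSeries ^ 6 * hP

theorem hauptmodulFive_ne_zero : hauptmodulFive ≠ 0 := by
  refine mul_ne_zero (mul_ne_zero X_ne_zero
    (pow_ne_zero _ expandFive_pentagonalSeries_ne_zero)) (pow_ne_zero _ fun h ↦ ?_)
  have := pentagonalSeries_mul_partitionSeries
  rw [h, mul_zero] at this
  exact zero_ne_one this

theorem progression_ramanujanZ_pow_mul_mem (i b : ℕ) :
    progression 5 0 (ramanujanZ ^ b * hauptmodulFive ^ i) ∈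
      adicSpan (fun k ↦ (5 * k - i - b - 1) / 2) ((i + b + 4) / 5) := by
  obtain ⟨g, hg, h⟩ := exists_pow_mul_eq_of_mem_adicSpan (i := i) (by omega)
    (progression_ramanujanZ_pow_mem (6 * i + b))
  rw [show ramanujanZ ^ (6 * i + b) =
    expandFive ℤ (hauptmodulFive ^ i) * (ramanujanZ ^ b * hauptmodulFive ^ i) by
      rw [pow_add, pow_mul, ← expandFive_hauptmodulFive_mul, map_pow]; ring,
    progression_expandFive_mul (by norm_num)] at h
  rw [← mul_left_cancel₀ (pow_ne_zero _ hauptmodulFive_ne_zero) h]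
  exact adicSpan_mono (by omega) (fun k hk ↦ by omega) hg

/-- The estimate `5 ^ (V + ⌊(5 k - s) / 2⌋) ∣ c k` for the coefficients of a combination
`∑ c k * u ^ k`, `k ≥ 1`, of powers of the Hauptmodul `u`. -/
noncomputable abbrev admissible (s V : ℕ) : AddSubgroup ℤ⟦X⟧ :=
  adicSpan (fun k ↦ V + (5 * k - s) / 2) 1

theorem progression_mem_admissible {V : ℕ} {f : ℤ⟦X⟧} (hf : f ∈ admissible 5 V) :
    progression 5 0 f ∈ admissible 4 (V + 1) := by
  refine map_mem_of_mem_adicSpan _ _ (fun i c hi hc ↦ ?_) hf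
  rw [progression_C_mul]
  have := progression_ramanujanZ_pow_mul_mem i 0
  rw [pow_zero, one_mul] at this
  refine C_mul_mem_adicSpan hc (by omega) (fun k hk ↦ ?_) this
  obtain rfl | hi := hi.eq_or_lt <;> omega

theorem progression_ramanujanZ_mul_mem_admissible {V : ℕ} {f : ℤ⟦X⟧} (hf : f ∈ admissible 5 V) :
    progression 5 0 (ramanujanZ * f) ∈ admissible 5 (V + 1) := by
  refine map_mem_of_mem_adicSpan ((progression 5 0).comp (AddMonoidHom.mulLeft ramanujanZ)) _
    (fun i c hi hc ↦ ?_) hf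
  rw [AddMonoidHom.comp_apply, AddMonoidHom.coe_mulLeft, mul_left_comm, progression_C_mul]
  have := progression_ramanujanZ_pow_mul_mem i 1
  rw [pow_one] at this
  refine C_mul_mem_adicSpan hc (by omega) (fun k hk ↦ ?_) this
  obtain rfl | hi := hi.eq_or_lt <;> omega

theorem admissible_mono {s t V : ℕ} (h : s ≤ t) : admissible s V ≤ admissible t V :=
  adicSpan_mono le_rfl fun k _ ↦ by omega

theorem X_mul_progression {r : ℕ} (hr : r < 5) (f : ℤ⟦X⟧) :
    X * progression 5 r f = progression 5 0 (X ^ (5 - r) * f) := by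
  ext n
  rw [coeff_progression, coeff_X_pow_mul']
  cases n with
  | zero =>
    rw [coeff_zero_X_mul, if_neg (by omega)]
  | succ n =>
    rw [coeff_succ_X_mul, if_pos (by omega), coeff_progression]
    congr 2
    omega

theorem X_mul_partitionSeries :
    X * partitionSeries = expandFive ℤ (expandFive ℤ partitionSeries) * ramanujanZ := by
  have h := congrArg (fun f ↦ expandFive ℤ (expandFive ℤ f)) pentagonalSeries_mul_partitionSeries
  simp only [map_mul, map_one] at h
  rw [ramanujanZ]
  linear_combination -X * partitionSeries * h

theorem X_mul_progression_four {f g : ℤ⟦X⟧}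
    (h : X * g = expandFive ℤ partitionSeries * f) :
    X * progression 5 4 g = partitionSeries * progression 5 0 f := by
  rw [X_mul_progression (by norm_num), pow_one, h, progression_expandFive_mul (by norm_num)]

theorem X_mul_progression_three {f g : ℤ⟦X⟧} (w : ℤ⟦X⟧)
    (h : X * g = partitionSeries * expandFive ℤ w * f) :
    X * progression 5 3 g =
      w * expandFive ℤ partitionSeries * progression 5 0 (ramanujanZ * f) := by
  rw [X_mul_progression (by norm_num), ← progression_expandFive_mul (by norm_num)]
  congr 1
  rw [map_mul]
  linear_combination X * h + expandFive ℤ w * f * X_mul_partitionSeries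

theorem X_mul_progression_partitionSeries (k d : ℕ) (hd : 24 * d = 19 * 5 ^ (2 * k + 1) + 1) :
    ∃ f ∈ admissible 5 (2 * k + 1),
      X * progression (5 ^ (2 * k + 1)) d partitionSeries = expandFive ℤ partitionSeries * f := by
  induction k generalizing d with
  | zero =>
    obtain rfl : d = 4 := by omega
    refine ⟨C 5 * hauptmodulFive ^ 1, C_mul_pow_mem_adicSpan le_rfl (by norm_num), ?_⟩
    rw [mul_zero, zero_add, pow_one, X_mul_progression (by norm_num), pow_one,
      X_mul_partitionSeries, progression_expandFive_mul (by norm_num),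
      progression_ramanujanZ_pow.1]
    simp
  | succ k ih =>
    have h5 : 5 ^ (2 * (k + 1) + 1) = 25 * 5 ^ (2 * k + 1) := by ring
    rw [h5] at hd ⊢
    generalize 5 ^ (2 * k + 1) = N at *
    obtain ⟨d', rfl⟩ : ∃ d', d = N * 19 + d' := ⟨d - N * 19, by omega⟩
    obtain ⟨f, hf, h⟩ := ih d' (by omega)
    have h1 := X_mul_progression_four h
    have h2 := X_mul_progression_three (f := progression 5 0 f)
      (g := progression 5 4 (progression N d' partitionSeries)) 1 (by rwa [map_one, mul_one])
    rw [progression_progression, progression_progression] at h2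
    refine ⟨_, progression_ramanujanZ_mul_mem_admissible
      (admissible_mono (by norm_num) (progression_mem_admissible hf)), ?_⟩
    rw [one_mul] at h2
    rw [← h2, mul_comm 25 N]

theorem X_mul_progression_twoColor (k β d : ℕ)
    (hd : 24 * d = 18 * 5 ^ (2 * k + 1 + β) + 5 ^ (2 * k + 1) + 1) :
    ∃ f ∈ admissible 5 (2 * k + 1 + β),
      X * progression (5 ^ (2 * k + 1 + β)) d (partitionSeries *
        expand (5 ^ (2 * k + 1)) (by positivity) partitionSeries) =
      partitionSeries * expandFive ℤ partitionSeries * f := by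
  induction β generalizing d with
  | zero =>
    rw [add_zero] at hd ⊢
    obtain ⟨f, hf, h⟩ := X_mul_progression_partitionSeries k d (by omega)
    refine ⟨f, hf, ?_⟩
    rw [mul_comm partitionSeries (expand _ _ _), progression_expand_mul]
    · linear_combination partitionSeries * h
    · have : 0 < 5 ^ (2 * k) := by positivity
      have : 5 ^ (2 * k + 1) = 5 * 5 ^ (2 * k) := by ring
      omega
  | succ β ih =>
    have h5 : 5 ^ (2 * k + 1 + (β + 1)) = 5 ^ (2 * k + 1 + β) * 5 := by ring
    rw [h5] at hd ⊢
    obtain ⟨d', rfl⟩ : ∃ d', d = 5 ^ (2 * k + 1 + β) * 3 + d' :=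
      Nat.exists_eq_add_of_le (by
        generalize 5 ^ (2 * k + 1 + β) = a at hd ⊢
        generalize 5 ^ (2 * k + 1) = b at hd
        omega)
    obtain ⟨f, hf, h⟩ := ih d' (by omega)
    refine ⟨_, progression_ramanujanZ_mul_mem_admissible hf, ?_⟩
    rw [← X_mul_progression_three _ h, progression_progression]

/-- For all `n, β ≥ 0` and `k ≥ 1`, `24` divides `18·5^{2k+β-1} + 5^{2k-1} + 1` and
`p_{1,5^{2k-1}}(5^{2k+β-1} n + (18·5^{2k+β-1} + 5^{2k-1} + 1)/24) ≡ 0 (mod 5^{2k+β-1})`. -/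
theorem twoColorCongruence_odd (n β k : ℕ) (hk : 1 ≤ k) :
    24 ∣ 18 * 5 ^ (2 * k + β - 1) + 5 ^ (2 * k - 1) + 1 ∧
      5 ^ (2 * k + β - 1) ∣
        p1 (5 ^ (2 * k - 1))
          (5 ^ (2 * k + β - 1) * n +
            (18 * 5 ^ (2 * k + β - 1) + 5 ^ (2 * k - 1) + 1) / 24) := by
  obtain ⟨k, rfl⟩ := Nat.exists_eq_add_of_le' hk
  rw [show 2 * (k + 1) + β - 1 = 2 * k + 1 + β by omega,
    show 2 * (k + 1) - 1 = 2 * k + 1 by omega]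
  have hdvd : 24 ∣ 18 * 5 ^ (2 * k + 1 + β) + 5 ^ (2 * k + 1) + 1 := by
    have h1 : 5 ^ (2 * k + 1 + β) % 4 = 1 := by simp [Nat.pow_mod]
    have h2 : 5 ^ (2 * k + 1) % 24 = 5 := by simp [pow_succ, pow_mul, Nat.mul_mod, Nat.pow_mod]
    omega
  refine ⟨hdvd, ?_⟩
  obtain ⟨f, hf, h⟩ := X_mul_progression_twoColor k β _ (Nat.mul_div_cancel' hdvd)
  have hn := dvd_coeff_mul_of_mem_adicSpan (e := 2 * k + 1 + β) (fun j _ ↦ Nat.le_add_right _ _)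
    hf (partitionSeries * expandFive ℤ partitionSeries) (n + 1)
  rw [← h, coeff_succ_X_mul, coeff_progression, coeff_partitionSeries_mul_expand] at hn
  exact_mod_cast hn
end

section
/- For all integers n ≥ 0, β ≥ 0 and k ≥ 1, the number 24 divides 22·5^{2k+2β} + 5^{2k} + 1, and p_{1,5^{2k}}(5^{2k+2β}·n + (22·5^{2k+2β} + 5^{2k} + 1)/24) ≡ 0 (mod 5^{2k+β}). -/
open PowerSeries


namespace TwoColor

open Finset

/-! ### Dissection of power series modulo `m` -/

section Dissection

variable {R : Type*} [CommRing R]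

/-- The power series `∑ a (m * n + r) * X ^ n` extracted from `∑ a n * X ^ n`. -/
noncomputable def extract (m r : ℕ) : R⟦X⟧ →ₗ[R] R⟦X⟧ where
  toFun f := PowerSeries.mk fun n => coeff (m * n + r) f
  map_add' f g := by ext; simp
  map_smul' c f := by ext; simp

@[simp]
theorem coeff_extract (m r n : ℕ) (f : R⟦X⟧) :
    coeff n (extract m r f) = coeff (m * n + r) f := by
  simp [extract]

theorem extract_expand_mul {m r : ℕ} (hm : m ≠ 0) (hr : r < m) (f g : R⟦X⟧) :
    extract m r (expand m hm f * g) = f * extract m r g := by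
  ext n
  rw [coeff_extract, coeff_mul, coeff_mul]
  symm
  refine Finset.sum_of_injOn (fun p => (m * p.1, m * p.2 + r)) ?_ ?_ ?_ ?_
  · rintro ⟨a, b⟩ - ⟨c, d⟩ - h
    simp only [Prod.mk.injEq, add_left_inj] at h
    exact Prod.ext (Nat.eq_of_mul_eq_mul_left (by omega) h.1)
      (Nat.eq_of_mul_eq_mul_left (by omega) h.2)
  · rintro ⟨a, b⟩ h
    simp only [mem_coe, HasAntidiagonal.mem_antidiagonal] at h ⊢
    rw [← h]
    ring
  · rintro ⟨a, b⟩ h h'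
    by_cases hd : m ∣ a
    · obtain ⟨a, rfl⟩ := hd
      refine absurd ?_ h'
      rw [HasAntidiagonal.mem_antidiagonal] at h
      have ha : a ≤ n := by
        by_contra! hlt
        have := Nat.mul_le_mul_left m hlt
        rw [Nat.mul_succ] at this
        dsimp only at h
        omega
      refine ⟨(a, n - a), by simp [ha], ?_⟩
      obtain ⟨d, rfl⟩ := Nat.exists_eq_add_of_le ha
      simp only [Nat.add_sub_cancel_left, Prod.mk.injEq, true_and]
      rw [mul_add] at h
      dsimp only at h
      omega
    · rw [coeff_expand_of_not_dvd m hm _ hd, zero_mul]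
  · rintro ⟨a, b⟩ -
    simp

theorem extract_expand {m : ℕ} (hm : m ≠ 0) (f : R⟦X⟧) :
    extract m 0 (expand m hm f) = f := by
  ext n
  simp

/-- Extracting the residue class of `0` after multiplying by a power of `X` that shifts the class
of `r` to that of `0`. -/
theorem extract_X_pow_mul {m r s : ℕ} (h : r + s = m) (f : R⟦X⟧) (hr : r < m) :
    extract m 0 (X ^ s * f) = X * extract m r f := by
  ext n
  rw [coeff_extract]
  rcases n with _ | n
  · rw [coeff_zero_X_mul, mul_zero, add_zero, coeff_X_pow_mul', if_neg (by omega)]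
  · rw [coeff_succ_X_mul, coeff_extract, coeff_X_pow_mul', if_pos (by rw [mul_add]; omega),
      show m * (n + 1) + 0 - s = m * n + r by rw [mul_add]; omega]

theorem extract_extract (m r m' r' : ℕ) (f : R⟦X⟧) :
    extract m' r' (extract m r f) = extract (m * m') (m * r' + r) f := by
  ext n
  simp only [coeff_extract]
  congr 1
  rw [mul_add, mul_assoc, add_assoc]

/-- All exponents occurring in `f` are congruent to `r` modulo `m`. -/
def IsResidue (m r : ℕ) (f : R⟦X⟧) : Prop :=
  ∀ n, coeff n f ≠ 0 → n ≡ r [MOD m]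

theorem IsResidue.mul {m r s : ℕ} {f g : R⟦X⟧} (hf : IsResidue m r f) (hg : IsResidue m s g) :
    IsResidue m (r + s) (f * g) := by
  intro n hn
  rw [coeff_mul] at hn
  obtain ⟨p, hp, hne⟩ := Finset.exists_ne_zero_of_sum_ne_zero hn
  rw [HasAntidiagonal.mem_antidiagonal] at hp
  rw [← hp]
  exact (hf _ (left_ne_zero_of_mul hne)).add (hg _ (right_ne_zero_of_mul hne))

theorem isResidue_one (m : ℕ) : IsResidue m 0 (1 : R⟦X⟧) := by
  intro n hn
  rw [coeff_one] at hn
  rw [(ite_ne_right_iff.mp hn).1]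

theorem isResidue_X (m : ℕ) : IsResidue m 1 (X : R⟦X⟧) := by
  intro n hn
  rw [coeff_X] at hn
  rw [(ite_ne_right_iff.mp hn).1]

theorem IsResidue.pow {m r : ℕ} {f : R⟦X⟧} (hf : IsResidue m r f) (k : ℕ) :
    IsResidue m (k * r) (f ^ k) := by
  induction k with
  | zero => simpa using isResidue_one m
  | succ k ih => rw [pow_succ, add_mul, one_mul]; exact ih.mul hf

theorem IsResidue.extract_eq_zero {m r : ℕ} {f : R⟦X⟧} (hf : IsResidue m r f)
    (hr : ¬ r ≡ 0 [MOD m]) : extract m 0 f = 0 := by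
  ext n
  rw [coeff_extract, add_zero, map_zero]
  by_contra hne
  exact hr ((hf _ hne).symm.trans (Nat.modEq_zero_iff_dvd.mpr (dvd_mul_right m n)))

theorem IsResidue.rescale {m r : ℕ} {f : R⟦X⟧} (hf : IsResidue m r f) {ω : R} (hω : ω ^ m = 1) :
    PowerSeries.rescale ω f = C (ω ^ r) * f := by
  ext n
  rw [coeff_rescale, coeff_C_mul]
  by_cases hn : coeff n f = 0
  · simp [hn]
  · rw [pow_eq_pow_of_modEq (hf n hn) hω]

theorem IsResidue.map {S : Type*} [CommRing S] {m r : ℕ} {f : R⟦X⟧} (hf : IsResidue m r f)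
    (φ : R →+* S) : IsResidue m r (PowerSeries.map φ f) := by
  intro n hn
  refine hf n fun h => hn ?_
  rw [coeff_map, h, map_zero]

/-- The part of a power series with exponents congruent to `r` modulo `m`. -/
noncomputable def residuePart (m r : ℕ) (f : R⟦X⟧) : R⟦X⟧ :=
  PowerSeries.mk fun n => if n % m = r % m then coeff n f else 0

theorem coeff_residuePart (m r n : ℕ) (f : R⟦X⟧) :
    coeff n (residuePart m r f) = if n % m = r % m then coeff n f else 0 := by
  simp [residuePart]

theorem isResidue_residuePart (m r : ℕ) (f : R⟦X⟧) : IsResidue m r (residuePart m r f) := by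
  intro n hn
  rw [coeff_residuePart] at hn
  exact (ite_ne_right_iff.mp hn).1

end Dissection

/-! ### The 5-dissection of the Euler product -/

section Pentagonal

/-- The Euler product `∏ (1 - X ^ n)`. -/
noncomputable abbrev euler : ℤ⟦X⟧ := pentagonalSeries ℤ

/-- Pairs of integers whose pentagonal numbers add up to `N`. -/
noncomputable def pentagonalPairs (N : ℕ) : Finset (ℤ × ℤ) :=
  (Icc (-N : ℤ) N ×ˢ Icc (-N : ℤ) N).filter fun p => pentagonal p.1 + pentagonal p.2 = N

theorem abs_le_pentagonal (k : ℤ) : |k| ≤ pentagonal k := by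
  have h := two_mul_natCast_pentagonal k
  rcases le_or_gt k 0 with hk | hk
  · rw [abs_of_nonpos hk]
    nlinarith
  · rw [abs_of_pos hk]
    nlinarith

theorem mem_pentagonalPairs {N : ℕ} {p : ℤ × ℤ} :
    p ∈ pentagonalPairs N ↔ pentagonal p.1 + pentagonal p.2 = N := by
  have h1 := abs_le.mp (abs_le_pentagonal p.1)
  have h2 := abs_le.mp (abs_le_pentagonal p.2)
  simp only [pentagonalPairs, mem_filter, mem_product, mem_Icc, and_iff_right_iff_imp]
  omega

theorem coeff_mul_of_pentagonal {f g : ℤ⟦X⟧}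
    (hf : ∀ n, n ∉ Set.range pentagonal → coeff n f = 0)
    (hg : ∀ n, n ∉ Set.range pentagonal → coeff n g = 0) (N : ℕ) :
    coeff N (f * g) =
      ∑ p ∈ pentagonalPairs N, coeff (pentagonal p.1) f * coeff (pentagonal p.2) g := by
  rw [coeff_mul]
  symm
  refine Finset.sum_of_injOn (fun p => (pentagonal p.1, pentagonal p.2)) ?_ ?_ ?_ ?_
  · rintro ⟨a, b⟩ - ⟨c, d⟩ - h
    simpa using h
  · intro p hp
    simpa using mem_pentagonalPairs.mp hp
  · rintro ⟨a, b⟩ h h'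
    by_cases ha : a ∈ Set.range pentagonal
    · by_cases hb : b ∈ Set.range pentagonal
      · obtain ⟨k, rfl⟩ := ha
        obtain ⟨l, rfl⟩ := hb
        exact absurd ⟨(k, l), mem_pentagonalPairs.mpr (by simpa using h), rfl⟩ h'
      · rw [hg b hb, mul_zero]
    · rw [hf a ha, zero_mul]
  · intro p _
    rfl

theorem pentagonal_emod_five (k : ℤ) : (pentagonal k : ℤ) % 5 = 3 * (k * (3 * k - 1)) % 5 := by
  have h := two_mul_natCast_pentagonal k
  omega

theorem pentagonal_mod_five (k : ℤ) :
    (pentagonal k % 5 = 0 ∧ (k % 5 = 0 ∨ k % 5 = 2)) ∨ (pentagonal k % 5 = 1 ∧ k % 5 = 1) ∨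
      (pentagonal k % 5 = 2 ∧ (k % 5 = 3 ∨ k % 5 = 4)) := by
  have h := pentagonal_emod_five k
  have h5 : k % 5 = 0 ∨ k % 5 = 1 ∨ k % 5 = 2 ∨ k % 5 = 3 ∨ k % 5 = 4 := by omega
  rcases h5 with h5 | h5 | h5 | h5 | h5 <;>
    simp [Int.mul_emod, Int.sub_emod, h5] at h <;> omega

/-- The reflection `(a, b) ↦ (-(3 * a + 4 * b), 3 * b - 4 * a) / 5` of the plane, in the coordinates
`a = 6 * k - 1`, `b = 6 * l - 1`; it preserves `pentagonal k + pentagonal l` and reverses the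
sign of the corresponding term of `euler ^ 2`. -/
theorem sum_pentagonalPairs_reflection (N : ℕ) :
    ∑ p ∈ pentagonalPairs N with (p.1 + 3 * p.2) % 5 = 4,
      (Int.negOnePow p.1 * Int.negOnePow p.2 : ℤ) = 0 := by
  have key : ∀ k l : ℤ, (k + 3 * l) % 5 = 4 → ∃ m, k = 4 - 3 * l + 5 * m ∧
      (2 - 3 * k - 4 * l) / 5 = l - 2 - 3 * m ∧ (3 * l - 4 * k + 1) / 5 = 3 * l - 3 - 4 * m := by
    intro k l h
    exact ⟨(k + 3 * l - 4) / 5, by omega, by omega, by omega⟩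
  have hsign : ∀ k l k' l' : ℤ, Odd (k' + l' - (k + l)) →
      (Int.negOnePow k * Int.negOnePow l : ℤ) + (Int.negOnePow k' * Int.negOnePow l' : ℤ) = 0 := by
    intro k l k' l' h
    have h1 : ((k + l).negOnePow : ℤ) = -((k' + l').negOnePow : ℤ) := by
      rw [show k' + l' = (k + l) + (k' + l' - (k + l)) by ring, Int.negOnePow_add (k + l),
        Int.negOnePow_odd _ h]
      simp
    rw [Int.negOnePow_add, Int.negOnePow_add] at h1
    push_cast at h1
    linear_combination h1
  refine Finset.sum_involution
    (fun p _ => ((2 - 3 * p.1 - 4 * p.2) / 5, (3 * p.2 - 4 * p.1 + 1) / 5)) ?_ ?_ ?_ ?_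
  · rintro ⟨k, l⟩ h
    obtain ⟨m, rfl, h1, h2⟩ := key k l (mem_filter.mp h).2
    refine hsign _ _ _ _ ?_
    dsimp only
    rw [h1, h2]
    exact ⟨3 * l - 5 - 6 * m, by ring⟩
  · rintro ⟨k, l⟩ h - heq
    obtain ⟨m, rfl, h1, h2⟩ := key k l (mem_filter.mp h).2
    simp only [h1, h2, Prod.mk.injEq] at heq
    omega
  · rintro ⟨k, l⟩ h
    rw [mem_filter, mem_pentagonalPairs] at h ⊢
    obtain ⟨m, rfl, h1, h2⟩ := key k l h.2
    simp only [h1, h2]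
    refine ⟨?_, by omega⟩
    rw [← h.1]
    have e1 := two_mul_natCast_pentagonal (4 - 3 * l + 5 * m)
    have e2 := two_mul_natCast_pentagonal l
    have e3 := two_mul_natCast_pentagonal (l - 2 - 3 * m)
    have e4 := two_mul_natCast_pentagonal (3 * l - 3 - 4 * m)
    zify
    linarith
  · rintro ⟨k, l⟩ h
    obtain ⟨m, rfl, h1, h2⟩ := key k l (mem_filter.mp h).2
    simp only [h1, h2, Prod.mk.injEq]
    constructor <;> omega

end Pentagonal

section EulerDissection

theorem sum_pentagonalPairs_reflection_swap (N : ℕ) :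
    ∑ p ∈ pentagonalPairs N with (p.2 + 3 * p.1) % 5 = 4,
      (Int.negOnePow p.1 * Int.negOnePow p.2 : ℤ) = 0 := by
  rw [← sum_pentagonalPairs_reflection N]
  refine Finset.sum_equiv (Equiv.prodComm ℤ ℤ) ?_ ?_
  · rintro ⟨k, l⟩
    simp [mem_pentagonalPairs, add_comm (pentagonal k)]
  · rintro ⟨k, l⟩ -
    simp [mul_comm]

theorem coeff_residuePart_euler_eq_zero {r n : ℕ} (h : n ∉ Set.range pentagonal) :
    coeff n (residuePart 5 r euler) = 0 := by
  rw [coeff_residuePart, coeff_pentagonalSeries_eq_zero ℤ h, ite_self]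

theorem euler_eq_add :
    euler = residuePart 5 0 euler + residuePart 5 1 euler + residuePart 5 2 euler := by
  ext n
  by_cases h : n ∈ Set.range pentagonal
  · obtain ⟨k, rfl⟩ := h
    simp only [map_add, coeff_residuePart]
    rcases pentagonal_mod_five k with ⟨h, -⟩ | ⟨h, -⟩ | ⟨h, -⟩ <;> simp [h]
  · simp only [map_add, coeff_residuePart_euler_eq_zero h,
      coeff_pentagonalSeries_eq_zero ℤ h, add_zero]

theorem residuePart_euler_one :
    residuePart 5 1 euler = -(X * expand 25 (by norm_num) euler) := by
  have hpent : ∀ j : ℤ, pentagonal (5 * j + 1) = 25 * pentagonal (-j) + 1 := by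
    intro j
    have h1 := two_mul_natCast_pentagonal (5 * j + 1)
    have h2 := two_mul_natCast_pentagonal (-j)
    zify
    linarith
  ext n
  rw [coeff_residuePart, map_neg]
  rcases n with _ | n
  · simp
  rw [coeff_succ_X_mul]
  by_cases h : ∃ j, n = 25 * pentagonal (-j)
  · obtain ⟨j, rfl⟩ := h
    rw [if_pos (by omega), coeff_expand_mul, ← hpent, coeff_pentagonalSeries_pentagonal,
      coeff_pentagonalSeries_pentagonal, Int.negOnePow_neg, Int.negOnePow_add,
      show 5 * j = j + 2 * (2 * j) by ring, Int.negOnePow_add, Int.negOnePow_two_mul]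
    simp
  · have h0 : coeff n (expand 25 (by norm_num) euler) = 0 := by
      rw [coeff_expand]
      split_ifs with hd
      · refine coeff_pentagonalSeries_eq_zero ℤ ?_
        rintro ⟨k, hk⟩
        refine h ⟨-k, ?_⟩
        rw [neg_neg, hk]
        omega
      · rfl
    rw [h0, neg_zero]
    split_ifs with hn
    · refine coeff_pentagonalSeries_eq_zero ℤ ?_
      rintro ⟨k, hk⟩
      have hk1 : k % 5 = 1 := by
        have := pentagonal_mod_five k
        omega
      obtain ⟨j, rfl⟩ : ∃ j, k = 5 * j + 1 := ⟨k / 5, by omega⟩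
      refine h ⟨j, ?_⟩
      have := hpent j
      omega
    · rfl

theorem residuePart_euler_zero_mul_two :
    residuePart 5 0 euler * residuePart 5 2 euler = -residuePart 5 1 euler ^ 2 := by
  have h : 2 * (residuePart 5 0 euler * residuePart 5 2 euler + residuePart 5 1 euler ^ 2) = 0 := by
    ext N
    have h1 := sum_pentagonalPairs_reflection N
    have h2 := sum_pentagonalPairs_reflection_swap N
    rw [sum_filter] at h1 h2
    rw [show 2 * (residuePart 5 0 euler * residuePart 5 2 euler + residuePart 5 1 euler ^ 2) =
      residuePart 5 0 euler * residuePart 5 2 euler + residuePart 5 2 euler * residuePart 5 0 euler +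
      residuePart 5 1 euler * residuePart 5 1 euler +
      residuePart 5 1 euler * residuePart 5 1 euler by ring]
    simp only [map_add, map_zero]
    refine Eq.trans ?_ ((congrArg₂ (· + ·) h1 h2).trans (add_zero 0))
    iterate 3 rw [coeff_mul_of_pentagonal (fun n => coeff_residuePart_euler_eq_zero)
      (fun n => coeff_residuePart_euler_eq_zero)]
    simp only [← sum_add_distrib]
    refine sum_congr rfl fun p _ => ?_
    obtain ⟨k, l⟩ := p
    simp only [coeff_residuePart, coeff_pentagonalSeries_pentagonal, Int.cast_id]
    rcases pentagonal_mod_five k with ⟨hk, hk' | hk'⟩ | ⟨hk, hk'⟩ | ⟨hk, hk' | hk'⟩ <;>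
      rcases pentagonal_mod_five l with ⟨hl, hl' | hl'⟩ | ⟨hl, hl'⟩ | ⟨hl, hl' | hl'⟩ <;>
      simp [hk, hl, Int.add_emod, Int.mul_emod, hk', hl']
  rw [mul_eq_zero] at h
  refine eq_neg_of_add_eq_zero_left (h.resolve_left fun h2 => ?_)
  have h3 := congrArg constantCoeff h2
  rw [map_ofNat, map_zero] at h3
  exact two_ne_zero h3

end EulerDissection

section EulerNorm

open PowerSeries.WithPiTopology

section Continuity

variable {R : Type*} [CommRing R] [TopologicalSpace R]

theorem continuous_of_continuous_coeff {α : Type*} [TopologicalSpace α] {f : α → R⟦X⟧}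
    (h : ∀ n, Continuous fun a => coeff n (f a)) : Continuous f :=
  continuous_iff_continuousAt.mpr fun a =>
    (tendsto_iff_coeff_tendsto R _ _ _).mpr fun n => (h n).tendsto a

theorem continuous_expand (p : ℕ) (hp : p ≠ 0) : Continuous (expand p hp (R := R)) := by
  refine continuous_of_continuous_coeff fun n => ?_
  simp only [coeff_expand]
  split_ifs
  · exact continuous_coeff R _
  · exact continuous_const

theorem continuous_rescale [IsTopologicalRing R] (c : R) :
    Continuous (PowerSeries.rescale c) := by
  refine continuous_of_continuous_coeff fun n => ?_
  simp only [coeff_rescale]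
  exact continuous_const.mul (continuous_coeff R n)

theorem hasProd_expand_pentagonalSeries (p : ℕ) (hp : p ≠ 0) :
    HasProd (fun n => (1 - X ^ (p * (n + 1)) : R⟦X⟧)) (expand p hp (pentagonalSeries R)) := by
  convert (hasProd_one_sub_X_pow R).map (expand p hp (R := R)) (continuous_expand p hp) using 2
  simp [pow_mul]

theorem hasProd_rescale_pentagonalSeries [IsTopologicalRing R] (c : R) :
    HasProd (fun n => (1 - C (c ^ (n + 1)) * X ^ (n + 1) : R⟦X⟧))
      (PowerSeries.rescale c (pentagonalSeries R)) := by
  convert (hasProd_one_sub_X_pow R).map (PowerSeries.rescale c) (continuous_rescale c) using 2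
  simp [rescale_X, mul_pow]

end Continuity

theorem hasProd_extend_mul {R : Type*} [CommRing R] [TopologicalSpace R] {m : ℕ} (hm : m ≠ 0)
    {f : ℕ → R⟦X⟧} {a : R⟦X⟧} (h : HasProd (fun n => f (m * (n + 1))) a) :
    HasProd (fun n => if m ∣ n + 1 then f (n + 1) else 1) a := by
  have hsucc (n : ℕ) : m * n + (m - 1) + 1 = m * (n + 1) := by
    rw [mul_add, mul_one, add_assoc, Nat.sub_add_cancel (Nat.one_le_iff_ne_zero.mpr hm)]
  have hinj : Function.Injective fun n : ℕ => m * n + (m - 1) := fun a b h =>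
    Nat.eq_of_mul_eq_mul_left (Nat.pos_of_ne_zero hm) (Nat.add_right_cancel h)
  rw [← hinj.hasProd_iff]
  · convert h using 2 with n
    rw [Function.comp_apply, hsucc, if_pos (dvd_mul_right m (n + 1))]
  · intro n hn
    rw [if_neg]
    rintro ⟨_ | k, hk⟩
    · simp at hk
    · exact hn ⟨k, Nat.succ_injective ((hsucc k).trans hk.symm)⟩

theorem prod_range_five_quadratic {R : Type*} [CommRing R] {ω : R}
    (hω : ∑ i ∈ range 5, ω ^ i = 0) (a b c : R) :
    ∏ j ∈ range 5, (a + ω ^ j * b + (ω ^ j) ^ 2 * c) =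
      a ^ 5 + b ^ 5 + c ^ 5 - 5 * a * b ^ 3 * c + 5 * a ^ 2 * b * c ^ 2 := by
  simp only [sum_range_succ, sum_range_zero, zero_add, pow_zero, pow_one] at hω
  have h5 : ω ^ 5 = 1 := by linear_combination (ω - 1) * hω
  have h14 : (a + ω * b + ω ^ 2 * c) * (a + ω ^ 4 * b + (ω ^ 4) ^ 2 * c) =
      a ^ 2 + b ^ 2 + c ^ 2 + (ω + ω ^ 4) * (a * b + b * c) + (ω ^ 2 + ω ^ 3) * (a * c) := by
    linear_combination (a * c * ω ^ 3 + b ^ 2 + b * c * (ω ^ 4 + ω) + c ^ 2 * (ω ^ 5 + 1)) * h5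
  have h23 : (a + ω ^ 2 * b + (ω ^ 2) ^ 2 * c) * (a + ω ^ 3 * b + (ω ^ 3) ^ 2 * c) =
      a ^ 2 + b ^ 2 + c ^ 2 + (ω ^ 2 + ω ^ 3) * (a * b + b * c) + (ω + ω ^ 4) * (a * c) := by
    linear_combination (a * c * ω + b ^ 2 + b * c * (ω ^ 3 + ω ^ 2) + c ^ 2 * (ω ^ 5 + 1)) * h5
  have hsum : (ω + ω ^ 4) + (ω ^ 2 + ω ^ 3) = -1 := by linear_combination hω
  have hmul : (ω + ω ^ 4) * (ω ^ 2 + ω ^ 3) = -1 := by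
    linear_combination hω + (ω + ω ^ 2) * h5
  calc ∏ j ∈ range 5, (a + ω ^ j * b + (ω ^ j) ^ 2 * c)
      = (a + b + c) * ((a + ω * b + ω ^ 2 * c) * (a + ω ^ 4 * b + (ω ^ 4) ^ 2 * c)) *
          ((a + ω ^ 2 * b + (ω ^ 2) ^ 2 * c) * (a + ω ^ 3 * b + (ω ^ 3) ^ 2 * c)) := by
        simp only [prod_range_succ, prod_range_zero]
        ring
    _ = _ := by
        rw [h14, h23]
        generalize ω + ω ^ 4 = s at *
        generalize ω ^ 2 + ω ^ 3 = t at *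
        linear_combination (a + b + c) * (((a ^ 2 + b ^ 2 + c ^ 2) * (a * b + b * c + a * c) +
          (a * b + b * c) * (a * c) * (s + t - 1)) * hsum +
          ((a * b + b * c) ^ 2 + (a * c) ^ 2 - 2 * (a * b + b * c) * (a * c)) * hmul)

theorem prod_rescale_pentagonalSeries {ω : ℂ} (hω : IsPrimitiveRoot ω 5) :
    (∏ j ∈ range 5, PowerSeries.rescale (ω ^ j) (pentagonalSeries ℂ)) *
      expand 25 (by norm_num) (pentagonalSeries ℂ) =
      expand 5 (by norm_num) (pentagonalSeries ℂ) ^ 6 := by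
  have hprod : HasProd
      (fun n => ∏ j ∈ range 5, (1 - C ((ω ^ j) ^ (n + 1)) * X ^ (n + 1) : ℂ⟦X⟧))
      (∏ j ∈ range 5, PowerSeries.rescale (ω ^ j) (pentagonalSeries ℂ)) :=
    hasProd_prod fun j _ => hasProd_rescale_pentagonalSeries _
  have h25 := hasProd_extend_mul (m := 5) (by norm_num)
    (f := fun n => (1 - X ^ (5 * n) : ℂ⟦X⟧))
    (a := expand 25 (by norm_num) (pentagonalSeries ℂ)) (by
      convert hasProd_expand_pentagonalSeries (R := ℂ) 25 (by norm_num) using 4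
      ring)
  have h5 := hasProd_extend_mul (m := 5) (by norm_num) (f := fun n => (1 - X ^ n : ℂ⟦X⟧))
    (hasProd_expand_pentagonalSeries (R := ℂ) 5 (by norm_num))
  have h5' := hasProd_expand_pentagonalSeries (R := ℂ) 5 (by norm_num)
  refine (hprod.mul h25).unique ?_
  rw [pow_succ]
  convert (h5.pow 5).mul h5' using 2 with n
  split_ifs with hn
  · obtain ⟨k, hk⟩ := hn
    have : ∀ j, (ω ^ j) ^ (n + 1) = 1 := by
      intro j
      rw [hk, ← pow_mul, mul_comm, mul_assoc, pow_mul, hω.pow_eq_one, one_pow]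
    simp [this]
  · have hζ : IsPrimitiveRoot (C (ω ^ (n + 1)) : ℂ⟦X⟧) 5 := by
      refine IsPrimitiveRoot.map_of_injective (hω.pow_of_coprime _ ?_) C_injective
      exact (Nat.Coprime.symm ((Nat.Prime.coprime_iff_not_dvd (by norm_num)).mpr hn))
    have := prod_range_five_quadratic (hζ.geom_sum_eq_zero (by norm_num)) 1 (-X ^ (n + 1)) 0
    rw [one_pow, one_mul, mul_one, mul_comm 5, pow_mul]
    convert this using 1
    · refine prod_congr rfl fun j _ => ?_
      simp only [← map_pow]
      rw [pow_right_comm]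
      ring
    · ring

theorem euler_quintic_norm :
    (residuePart 5 0 euler ^ 5 + 11 * residuePart 5 1 euler ^ 5 + residuePart 5 2 euler ^ 5) *
      expand 25 (by norm_num) euler = expand 5 (by norm_num) euler ^ 6 := by
  obtain ⟨ω, hω⟩ : ∃ ω : ℂ, IsPrimitiveRoot ω 5 :=
    ⟨_, Complex.isPrimitiveRoot_exp 5 (by norm_num)⟩
  have hmap : PowerSeries.map (Int.castRingHom ℂ) euler = pentagonalSeries ℂ := by
    ext n
    by_cases h : n ∈ Set.range pentagonal
    · obtain ⟨k, rfl⟩ := h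
      simp
    · simp [coeff_pentagonalSeries_eq_zero _ h]
  have hinj : Function.Injective (PowerSeries.map (Int.castRingHom ℂ)) :=
    PowerSeries.map_injective _ Int.cast_injective
  apply hinj
  have hrel := congrArg (PowerSeries.map (Int.castRingHom ℂ)) residuePart_euler_zero_mul_two
  have hsum := congrArg (PowerSeries.map (Int.castRingHom ℂ)) euler_eq_add
  rw [hmap] at hsum
  have h0 := (isResidue_residuePart 5 0 euler).map (Int.castRingHom ℂ)
  have h1 := (isResidue_residuePart 5 1 euler).map (Int.castRingHom ℂ)
  have h2 := (isResidue_residuePart 5 2 euler).map (Int.castRingHom ℂ)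
  simp only [map_mul, map_add, map_pow, map_neg, map_expand, hmap, map_ofNat] at hrel hsum ⊢
  generalize PowerSeries.map (Int.castRingHom ℂ) (residuePart 5 0 euler) = a at *
  generalize PowerSeries.map (Int.castRingHom ℂ) (residuePart 5 1 euler) = b at *
  generalize PowerSeries.map (Int.castRingHom ℂ) (residuePart 5 2 euler) = c at *
  rw [← prod_rescale_pentagonalSeries hω]
  congr 1
  have hω5 : ∀ j, (ω ^ j) ^ 5 = 1 := fun j => by rw [pow_right_comm, hω.pow_eq_one, one_pow]
  have hC : ∑ i ∈ range 5, (C ω : ℂ⟦X⟧) ^ i = 0 := by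
    simp only [← map_pow, ← map_sum]
    rw [hω.geom_sum_eq_zero (by norm_num), map_zero]
  rw [hsum]
  simp only [map_add, h0.rescale (hω5 _), h1.rescale (hω5 _), h2.rescale (hω5 _), map_pow,
    map_one, pow_zero, pow_one, one_mul]
  rw [prod_range_five_quadratic hC]
  linear_combination -5 * b * (a * c - 2 * b ^ 2) * hrel

end EulerNorm

/-! ### The `U` operator on polynomials in the Hauptmodul -/

section Hauptmodul

/-- The reciprocal of the Euler product. -/
noncomputable def eulerInv : ℤ⟦X⟧ := invOfUnit euler 1

theorem euler_mul_eulerInv : euler * eulerInv = 1 := by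
  refine mul_invOfUnit _ _ ?_
  rw [← coeff_zero_eq_constantCoeff_apply, show 0 = pentagonal 0 from rfl,
    coeff_pentagonalSeries_pentagonal]
  simp

/-- The Euler product in `X ^ 5`. -/
noncomputable def euler5 : ℤ⟦X⟧ := expand 5 (by norm_num) euler

/-- The Euler product in `X ^ 25`. -/
noncomputable def euler25 : ℤ⟦X⟧ := expand 25 (by norm_num) euler

theorem expand_five_euler5 : expand 5 (by norm_num) euler5 = euler25 :=
  (expand_mul 5 (by norm_num) 5 (by norm_num) euler).symm

/-- The quotient `X * E(X ^ 25) / E(X)` of Euler products. -/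
noncomputable def levelUnit : ℤ⟦X⟧ := X * euler25 * eulerInv

/-- The Hauptmodul `X * (E(X ^ 5) / E(X)) ^ 6`. -/
noncomputable def hauptmodul : ℤ⟦X⟧ := X * euler5 ^ 6 * eulerInv ^ 6

theorem levelUnit_mul_euler : levelUnit * euler = X * euler25 := by
  rw [levelUnit]
  linear_combination X * euler25 * euler_mul_eulerInv

theorem euler_quintic :
    (euler ^ 5 + 5 * (X * euler25) * euler ^ 4 + 15 * (X * euler25) ^ 2 * euler ^ 3 +
      25 * (X * euler25) ^ 3 * euler ^ 2 + 25 * (X * euler25) ^ 4 * euler) * euler25 =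
      euler5 ^ 6 := by
  have h := euler_quintic_norm
  have h1 := residuePart_euler_one
  have hrel := residuePart_euler_zero_mul_two
  have hsum := euler_eq_add
  rw [← euler25] at h h1
  rw [← euler5] at h
  rw [h1] at h hrel hsum
  rw [← h]
  congr 1
  generalize residuePart 5 0 euler = a at *
  generalize residuePart 5 2 euler = c at *
  generalize X * euler25 = e at *
  generalize euler = E at *
  subst hsum
  linear_combination (5 * a ^ 3 + 10 * a ^ 2 * c + 10 * a * c ^ 2 + 5 * a * e ^ 2 + 5 * c ^ 3 +
    5 * c * e ^ 2) * hrel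

theorem hauptmodul_eq : hauptmodul = levelUnit + 5 * levelUnit ^ 2 + 15 * levelUnit ^ 3 +
    25 * levelUnit ^ 4 + 25 * levelUnit ^ 5 := by
  have h := euler_quintic
  rw [← levelUnit_mul_euler] at h
  have hu : levelUnit = X * euler25 * eulerInv := rfl
  have hE := congrArg (· ^ 5) euler_mul_eulerInv
  simp only [mul_pow, one_pow] at hE
  rw [hauptmodul, ← h]
  generalize hv : 1 + 5 * levelUnit + 15 * levelUnit ^ 2 + 25 * levelUnit ^ 3 +
    25 * levelUnit ^ 4 = v
  calc _ = (X * euler25 * eulerInv) * v * (euler ^ 5 * eulerInv ^ 5) := by rw [← hv]; ring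
    _ = levelUnit * v := by rw [hE, ← hu, mul_one]
    _ = _ := by rw [← hv]; ring

theorem levelUnit_pow_five : levelUnit ^ 5 = expand 5 (by norm_num) hauptmodul *
    (1 + 5 * levelUnit + 15 * levelUnit ^ 2 + 25 * levelUnit ^ 3 + 25 * levelUnit ^ 4) := by
  have h := euler_quintic
  rw [← levelUnit_mul_euler] at h
  have hu : levelUnit = X * euler25 * eulerInv := rfl
  have hE := congrArg (· ^ 5) euler_mul_eulerInv
  have h5 := congrArg (fun f => (expand 5 (by norm_num) f) ^ 6) euler_mul_eulerInv
  simp only [mul_pow, one_pow, map_mul, map_one] at hE h5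
  rw [← euler5] at h5
  rw [hauptmodul, map_mul, map_mul, map_pow, map_pow, expand_five_euler5, expand_X]
  generalize hv : 1 + 5 * levelUnit + 15 * levelUnit ^ 2 + 25 * levelUnit ^ 3 +
    25 * levelUnit ^ 4 = v
  have h' : euler ^ 5 * v * euler25 = euler5 ^ 6 := by rw [← h, ← hv]; ring
  rw [hu]
  generalize expand 5 _ eulerInv = J at *
  linear_combination -(X * euler25 * eulerInv) ^ 5 * h5 - X ^ 5 * euler25 ^ 5 *
    eulerInv ^ 5 * J ^ 6 * h' + X ^ 5 * euler25 ^ 6 * J ^ 6 * v * hE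

theorem extract_monomial_eq_zero (i j k : ℕ) (h : (1 + j + k * 2) % 5 ≠ 0) :
    extract 5 0 (X * (residuePart 5 0 euler ^ i * (X * euler25) ^ j *
      residuePart 5 2 euler ^ k)) = 0 := by
  have he : IsResidue 5 1 (X * euler25) := by
    have := isResidue_residuePart 5 1 (-euler)
    have h1 := residuePart_euler_one
    rw [← euler25] at h1
    have h2 : residuePart 5 1 (-euler) = X * euler25 := by
      rw [← neg_neg (X * euler25), ← h1]
      ext n
      simp only [coeff_residuePart, map_neg]
      split_ifs <;> simp
    rwa [h2] at this
  have := (isResidue_X (R := ℤ) 5).mul ((((isResidue_residuePart 5 0 euler).pow i).mul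
    (he.pow j)).mul ((isResidue_residuePart 5 2 euler).pow k))
  refine this.extract_eq_zero fun h' => h ?_
  have h'' : (1 + (i * 0 + j * 1 + k * 2)) % 5 = 0 := h'
  omega

/-- The power series `X * E(X ^ 5) ^ 4`. -/
noncomputable def quarticWeight : ℤ⟦X⟧ := X * euler5 ^ 4

theorem X_mul_pow_four : X * (X * euler25) ^ 4 = expand 5 (by norm_num) quarticWeight := by
  rw [quarticWeight, map_mul, map_pow, expand_five_euler5, expand_X]
  ring

theorem extract_quartic (x : Fin 8 → ℤ) (y : ℤ) {f a c e : ℤ⟦X⟧}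
    (ha : residuePart 5 0 euler = a) (hc : residuePart 5 2 euler = c) (he : X * euler25 = e)
    (hf : f = x 0 • a ^ 4 + x 1 • (a ^ 3 * e) + x 2 • (a ^ 2 * e ^ 2) + x 3 • (a * e ^ 3) +
      x 4 • c ^ 4 + x 5 • (c ^ 3 * e) + x 6 • (c ^ 2 * e ^ 2) + x 7 • (c * e ^ 3) + y • e ^ 4) :
    extract 5 0 (X * f) = y • quarticWeight := by
  have key : X * f =
      x 0 • (X * (a ^ 4 * e ^ 0 * c ^ 0)) + x 1 • (X * (a ^ 3 * e ^ 1 * c ^ 0)) +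
      x 2 • (X * (a ^ 2 * e ^ 2 * c ^ 0)) + x 3 • (X * (a ^ 1 * e ^ 3 * c ^ 0)) +
      x 4 • (X * (a ^ 0 * e ^ 0 * c ^ 4)) + x 5 • (X * (a ^ 0 * e ^ 1 * c ^ 3)) +
      x 6 • (X * (a ^ 0 * e ^ 2 * c ^ 2)) + x 7 • (X * (a ^ 0 * e ^ 3 * c ^ 1)) +
      y • (X * e ^ 4) := by
    rw [hf]
    simp only [zsmul_eq_mul]
    ring
  subst ha hc he
  rw [key, X_mul_pow_four]
  simp only [map_add, map_zsmul, extract_expand]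
  rw [extract_monomial_eq_zero 4 0 0 (by norm_num), extract_monomial_eq_zero 3 1 0 (by norm_num),
    extract_monomial_eq_zero 2 2 0 (by norm_num), extract_monomial_eq_zero 1 3 0 (by norm_num),
    extract_monomial_eq_zero 0 0 4 (by norm_num), extract_monomial_eq_zero 0 1 3 (by norm_num),
    extract_monomial_eq_zero 0 2 2 (by norm_num), extract_monomial_eq_zero 0 3 1 (by norm_num)]
  simp

theorem X_mul_euler_pow_mul_levelUnit_pow {n : ℕ} (hn : n ≤ 4) :
    X * euler ^ 4 * levelUnit ^ n = X * (euler ^ (4 - n) * (X * euler25) ^ n) := by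
  rw [← levelUnit_mul_euler, mul_pow, mul_assoc, ← pow_sub_mul_pow euler hn]
  ring

/-- The values of the `U` operator on `X * E ^ 4 * u ^ n` for `n < 5`. -/
theorem extract_euler_pow_mul_levelUnit_pow :
    extract 5 0 (X * euler ^ 4 * levelUnit ^ 0) = (-5 : ℤ) • quarticWeight ∧
    extract 5 0 (X * euler ^ 4 * levelUnit ^ 1) = (5 : ℤ) • quarticWeight ∧
    extract 5 0 (X * euler ^ 4 * levelUnit ^ 2) = (-1 : ℤ) • quarticWeight ∧
    extract 5 0 (X * euler ^ 4 * levelUnit ^ 3) = (-1 : ℤ) • quarticWeight ∧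
    extract 5 0 (X * euler ^ 4 * levelUnit ^ 4) = (1 : ℤ) • quarticWeight := by
  have h1 := residuePart_euler_one
  have hrel := residuePart_euler_zero_mul_two
  have hsum := euler_eq_add
  rw [← euler25] at h1
  rw [h1] at hrel hsum
  rw [X_mul_euler_pow_mul_levelUnit_pow (by norm_num),
    X_mul_euler_pow_mul_levelUnit_pow (by norm_num),
    X_mul_euler_pow_mul_levelUnit_pow (by norm_num),
    X_mul_euler_pow_mul_levelUnit_pow (by norm_num),
    X_mul_euler_pow_mul_levelUnit_pow (by norm_num)]
  generalize ha : residuePart 5 0 euler = a at *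
  generalize hc : residuePart 5 2 euler = c at *
  generalize he : X * euler25 = e at *
  refine ⟨extract_quartic ![1, -4, 2, 8, 1, -4, 2, 8] _ ha hc he ?_,
    extract_quartic ![0, 1, -3, 0, 0, 1, -3, 0] _ ha hc he ?_,
    extract_quartic ![0, 0, 1, -2, 0, 0, 1, -2] _ ha hc he ?_,
    extract_quartic ![0, 0, 0, 1, 0, 0, 0, 1] _ ha hc he ?_,
    extract_quartic ![0, 0, 0, 0, 0, 0, 0, 0] _ ha hc he ?_⟩ <;>
  simp only [hsum, zsmul_eq_mul, Matrix.cons_val] <;> push_cast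
  · linear_combination (4 * a ^ 2 + 6 * a * c - 12 * a * e + 4 * c ^ 2 - 12 * c * e +
      6 * e ^ 2) * hrel
  · linear_combination (3 * a + 3 * c - 6 * e) * e * hrel
  · linear_combination 2 * e ^ 2 * hrel
  · ring
  · ring

theorem quarticWeight_ne_zero : quarticWeight ≠ 0 := by
  have h := congrArg (expand 5 (by norm_num)) euler_mul_eulerInv
  rw [map_mul, map_one, ← euler5] at h
  exact mul_ne_zero X_ne_zero (pow_ne_zero _ (left_ne_zero_of_mul_eq_one h))

theorem extract_euler_pow_mul_levelUnit_pow_add_four (n : ℕ) :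
    extract 5 0 (X * euler ^ 4 * levelUnit ^ (n + 4)) =
      quarticWeight * extract 5 0 (levelUnit ^ n) := by
  have key : X * euler ^ 4 * levelUnit ^ (n + 4) =
      expand 5 (by norm_num) quarticWeight * levelUnit ^ n := by
    rw [← X_mul_pow_four, ← levelUnit_mul_euler]
    ring
  rw [key, extract_expand_mul (by norm_num) (by norm_num)]

/-- The recursion satisfied by the `U` operator, coming from the modular equation for `u`. -/
theorem extract_mul_levelUnit_pow_add_five (f : ℤ⟦X⟧) (n : ℕ) :
    extract 5 0 (f * levelUnit ^ (n + 5)) = hauptmodul *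
      (extract 5 0 (f * levelUnit ^ n) + 5 * extract 5 0 (f * levelUnit ^ (n + 1)) +
        15 * extract 5 0 (f * levelUnit ^ (n + 2)) + 25 * extract 5 0 (f * levelUnit ^ (n + 3)) +
        25 * extract 5 0 (f * levelUnit ^ (n + 4))) := by
  have key : f * levelUnit ^ (n + 5) = expand 5 (by norm_num) hauptmodul *
      (f * levelUnit ^ n + (5 : ℤ) • (f * levelUnit ^ (n + 1)) +
        (15 : ℤ) • (f * levelUnit ^ (n + 2)) + (25 : ℤ) • (f * levelUnit ^ (n + 3)) +
        (25 : ℤ) • (f * levelUnit ^ (n + 4))) := by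
    rw [pow_add levelUnit n 5, levelUnit_pow_five]
    simp only [zsmul_eq_mul]
    push_cast
    ring
  rw [key, extract_expand_mul (by norm_num) (by norm_num)]
  simp only [map_add, map_zsmul]
  simp only [zsmul_eq_mul, Int.cast_ofNat]

theorem extract_levelUnit_pow :
    extract 5 0 (levelUnit ^ 1) = 5 * hauptmodul ∧
    extract 5 0 (levelUnit ^ 2) = 10 * hauptmodul + 125 * hauptmodul ^ 2 ∧
    extract 5 0 (levelUnit ^ 3) = 9 * hauptmodul + 375 * hauptmodul ^ 2 +
      3125 * hauptmodul ^ 3 ∧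
    extract 5 0 (levelUnit ^ 4) = 4 * hauptmodul + 550 * hauptmodul ^ 2 +
      12500 * hauptmodul ^ 3 + 78125 * hauptmodul ^ 4 := by
  obtain ⟨h0, h1, h2, h3, h4⟩ := extract_euler_pow_mul_levelUnit_pow
  have r5 := extract_mul_levelUnit_pow_add_five (X * euler ^ 4) 0
  have r6 := extract_mul_levelUnit_pow_add_five (X * euler ^ 4) 1
  have r7 := extract_mul_levelUnit_pow_add_five (X * euler ^ 4) 2
  have r8 := extract_mul_levelUnit_pow_add_five (X * euler ^ 4) 3
  have s1 := extract_euler_pow_mul_levelUnit_pow_add_four 1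
  have s2 := extract_euler_pow_mul_levelUnit_pow_add_four 2
  have s3 := extract_euler_pow_mul_levelUnit_pow_add_four 3
  have s4 := extract_euler_pow_mul_levelUnit_pow_add_four 4
  simp only [zero_add, Nat.reduceAdd, h0, h1, h2, h3, h4, zsmul_eq_mul] at r5 r6 r7 r8
  push_cast at r5 r6 r7 r8
  have e5 : extract 5 0 (X * euler ^ 4 * levelUnit ^ 5) = quarticWeight * (5 * hauptmodul) := by
    rw [r5]
    ring
  have e6 : extract 5 0 (X * euler ^ 4 * levelUnit ^ 6) =
      quarticWeight * (10 * hauptmodul + 125 * hauptmodul ^ 2) := by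
    rw [r6, e5]
    ring
  have e7 : extract 5 0 (X * euler ^ 4 * levelUnit ^ 7) =
      quarticWeight * (9 * hauptmodul + 375 * hauptmodul ^ 2 + 3125 * hauptmodul ^ 3) := by
    rw [r7, e6, e5]
    ring
  have e8 : extract 5 0 (X * euler ^ 4 * levelUnit ^ 8) =
      quarticWeight * (4 * hauptmodul + 550 * hauptmodul ^ 2 + 12500 * hauptmodul ^ 3 +
        78125 * hauptmodul ^ 4) := by
    rw [r8, e7, e6, e5]
    ring
  exact ⟨mul_left_cancel₀ quarticWeight_ne_zero (s1.symm.trans e5),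
    mul_left_cancel₀ quarticWeight_ne_zero (s2.symm.trans e6),
    mul_left_cancel₀ quarticWeight_ne_zero (s3.symm.trans e7),
    mul_left_cancel₀ quarticWeight_ne_zero (s4.symm.trans e8)⟩

end Hauptmodul

/-! ### Divisibility of the `U` operator -/

section Filtration

theorem extract_natCast_mul {R : Type*} [CommRing R] (m r c : ℕ) (f : R⟦X⟧) :
    extract m r ((c : R⟦X⟧) * f) = c * extract m r f := by
  rw [← nsmul_eq_mul, ← nsmul_eq_mul, map_nsmul]

/-- The integral combinations of the `5 ^ e i * t ^ (i + 1)`, for `t` the Hauptmodul. -/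
noncomputable def hauptSpan (e : ℕ → ℕ) : AddSubgroup ℤ⟦X⟧ :=
  AddSubgroup.closure (Set.range fun i => ((5 ^ e i : ℕ) : ℤ⟦X⟧) * hauptmodul ^ (i + 1))

theorem map_mem_of_mem_hauptSpan {e : ℕ → ℕ} {S : AddSubgroup ℤ⟦X⟧} (L : ℤ⟦X⟧ →+ ℤ⟦X⟧)
    (h : ∀ i, L (((5 ^ e i : ℕ) : ℤ⟦X⟧) * hauptmodul ^ (i + 1)) ∈ S) {f : ℤ⟦X⟧}
    (hf : f ∈ hauptSpan e) : L f ∈ S := by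
  have : hauptSpan e ≤ S.comap L := by
    rw [hauptSpan, AddSubgroup.closure_le]
    rintro _ ⟨i, rfl⟩
    exact h i
  exact this hf

theorem natCast_mul_hauptmodul_pow_mem {e : ℕ → ℕ} {i c : ℕ} (h : 5 ^ e i ∣ c) :
    (c : ℤ⟦X⟧) * hauptmodul ^ (i + 1) ∈ hauptSpan e := by
  obtain ⟨d, rfl⟩ := h
  have := (hauptSpan e).nsmul_mem (AddSubgroup.subset_closure (Set.mem_range_self i)) d
  rw [nsmul_eq_mul] at this
  convert this using 1
  push_cast
  ring

theorem natCast_mul_mem_hauptSpan {e e' : ℕ → ℕ} {c : ℕ} (h : ∀ i, 5 ^ e' i ∣ c * 5 ^ e i)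
    {f : ℤ⟦X⟧} (hf : f ∈ hauptSpan e) : (c : ℤ⟦X⟧) * f ∈ hauptSpan e' := by
  refine map_mem_of_mem_hauptSpan (AddMonoidHom.mulLeft (c : ℤ⟦X⟧)) (fun i => ?_) hf
  have := natCast_mul_hauptmodul_pow_mem (h i)
  rw [Nat.cast_mul, mul_assoc] at this
  exact this

theorem five_pow_mul_mem_hauptSpan {e e' : ℕ → ℕ} {c : ℕ} (h : ∀ i, e' i ≤ c + e i)
    {f : ℤ⟦X⟧} (hf : f ∈ hauptSpan e) : ((5 ^ c : ℕ) : ℤ⟦X⟧) * f ∈ hauptSpan e' :=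
  natCast_mul_mem_hauptSpan (fun i => by rw [← pow_add]; exact pow_dvd_pow 5 (h i)) hf

theorem hauptSpan_mono {e e' : ℕ → ℕ} (h : ∀ i, e' i ≤ e i) : hauptSpan e ≤ hauptSpan e' := by
  intro f hf
  simpa using five_pow_mul_mem_hauptSpan (c := 0) (by simpa using h) hf

theorem hauptmodul_mul_mem_hauptSpan {e e' : ℕ → ℕ} (h : ∀ i, e' (i + 1) ≤ e i)
    {f : ℤ⟦X⟧} (hf : f ∈ hauptSpan e) : hauptmodul * f ∈ hauptSpan e' := by
  refine map_mem_of_mem_hauptSpan (AddMonoidHom.mulLeft hauptmodul) (fun i => ?_) hf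
  have := natCast_mul_hauptmodul_pow_mem (pow_dvd_pow 5 (h i))
  rw [pow_succ, ← mul_assoc, mul_comm] at this
  exact this

/-- The exponents of `5` occurring in the expansion of `U (u ^ n)` in the Hauptmodul. -/
def unitExp (n i : ℕ) : ℕ := (5 * i + 4 - n) / 2

theorem quartic_combination_mem_hauptSpan (n : ℕ) {f : ℕ → ℤ⟦X⟧}
    (hf : ∀ j < 5, f j ∈ hauptSpan (unitExp (n + j))) :
    f 0 + 5 * f 1 + 15 * f 2 + 25 * f 3 + 25 * f 4 ∈ hauptSpan (unitExp n) := by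
  have h1 := five_pow_mul_mem_hauptSpan (c := 1) (e' := unitExp n)
    (fun i => by unfold unitExp; omega) (hf 1 (by norm_num))
  have h2 := five_pow_mul_mem_hauptSpan (c := 1) (e' := unitExp n)
    (fun i => by unfold unitExp; omega) (hf 2 (by norm_num))
  have h3 := five_pow_mul_mem_hauptSpan (c := 2) (e' := unitExp n)
    (fun i => by unfold unitExp; omega) (hf 3 (by norm_num))
  have h4 := five_pow_mul_mem_hauptSpan (c := 2) (e' := unitExp n)
    (fun i => by unfold unitExp; omega) (hf 4 (by norm_num))
  have h0 : f 0 ∈ hauptSpan (unitExp n) := hf 0 (by norm_num)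
  have := add_mem (add_mem (add_mem (add_mem h0 h1)
    (nsmul_mem h2 3)) h3) h4
  convert this using 1
  rw [nsmul_eq_mul]
  push_cast
  ring

theorem extract_levelUnit_pow_mem (n : ℕ) :
    extract 5 0 (levelUnit ^ (n + 1)) ∈ hauptSpan (unitExp (n + 1)) := by
  induction n using Nat.strong_induction_on with
  | _ n ih =>
    obtain ⟨h1, h2, h3, h4⟩ := extract_levelUnit_pow
    have hm {c i n : ℕ} (h : 5 ^ unitExp n i ∣ c) := natCast_mul_hauptmodul_pow_mem h
    have m1 : extract 5 0 (levelUnit ^ 1) ∈ hauptSpan (unitExp 1) := by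
      rw [h1]
      convert hm (c := 5) (i := 0) (n := 1) (by decide) using 1
      push_cast
      ring
    have m2 : extract 5 0 (levelUnit ^ 2) ∈ hauptSpan (unitExp 2) := by
      rw [h2]
      convert add_mem (hm (c := 10) (i := 0) (n := 2) (by decide))
        (hm (c := 125) (i := 1) (n := 2) (by decide)) using 1
      push_cast
      ring
    have m3 : extract 5 0 (levelUnit ^ 3) ∈ hauptSpan (unitExp 3) := by
      rw [h3]
      convert add_mem (add_mem (hm (c := 9) (i := 0) (n := 3) (by decide))
        (hm (c := 375) (i := 1) (n := 3) (by decide)))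
        (hm (c := 3125) (i := 2) (n := 3) (by decide)) using 1
      push_cast
      ring
    have m4 : extract 5 0 (levelUnit ^ 4) ∈ hauptSpan (unitExp 4) := by
      rw [h4]
      convert add_mem (add_mem (add_mem (hm (c := 4) (i := 0) (n := 4) (by decide))
        (hm (c := 550) (i := 1) (n := 4) (by decide)))
        (hm (c := 12500) (i := 2) (n := 4) (by decide)))
        (hm (c := 78125) (i := 3) (n := 4) (by decide)) using 1
      push_cast
      ring
    match n, ih with
    | 0, _ => exact m1
    | 1, _ => exact m2
    | 2, _ => exact m3
    | 3, _ => exact m4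
    | 4, _ =>
      have hrec := extract_mul_levelUnit_pow_add_five 1 0
      simp only [one_mul, zero_add, pow_zero] at hrec
      have hone : extract 5 0 (1 : ℤ⟦X⟧) = 1 := by
        simpa using extract_expand (R := ℤ) (m := 5) (by norm_num) 1
      rw [hone] at hrec
      have hq := quartic_combination_mem_hauptSpan 0
        (f := fun j => if j = 0 then 0 else extract 5 0 (levelUnit ^ j)) (fun j hj => by
          interval_cases j
          · exact zero_mem _
          · exact m1
          · exact m2
          · exact m3
          · exact m4)
      have hq' := hauptmodul_mul_mem_hauptSpan (e' := unitExp 5)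
        (fun i => by unfold unitExp; omega) hq
      rw [hrec]
      convert add_mem (hm (c := 1) (i := 0) (n := 5) (by decide)) hq' using 1
      simp
      ring
    | n + 5, ih =>
      have hrec := extract_mul_levelUnit_pow_add_five 1 (n + 1)
      simp only [one_mul] at hrec
      rw [show n + 5 + 1 = n + 1 + 5 by ring, hrec]
      refine hauptmodul_mul_mem_hauptSpan (e := unitExp (n + 1))
        (fun i => by unfold unitExp; omega) ?_
      refine quartic_combination_mem_hauptSpan (n + 1)
        (f := fun j => extract 5 0 (levelUnit ^ (n + 1 + j))) fun j hj => ?_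
      rw [add_right_comm]
      exact ih (n + j) (by omega)

theorem extract_levelUnit_pow_mul_hauptmodul_pow_mem (i n : ℕ) (h : 1 ≤ n + i) :
    extract 5 0 (levelUnit ^ n * hauptmodul ^ i) ∈ hauptSpan (unitExp (n + i)) := by
  induction i generalizing n with
  | zero =>
    obtain ⟨n, rfl⟩ := Nat.exists_eq_add_of_le' h
    simpa using extract_levelUnit_pow_mem n
  | succ i ih =>
    have hq := quartic_combination_mem_hauptSpan (n + (i + 1))
      (f := fun j => extract 5 0 (levelUnit ^ (n + 1 + j) * hauptmodul ^ i)) fun j _ => by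
        rw [show n + (i + 1) + j = n + 1 + j + i by ring]
        exact ih (n + 1 + j) (by omega)
    convert hq using 1
    have key : levelUnit ^ n * hauptmodul ^ (i + 1) =
        levelUnit ^ (n + 1 + 0) * hauptmodul ^ i +
        (5 : ℕ) * (levelUnit ^ (n + 1 + 1) * hauptmodul ^ i) +
        (15 : ℕ) * (levelUnit ^ (n + 1 + 2) * hauptmodul ^ i) +
        (25 : ℕ) * (levelUnit ^ (n + 1 + 3) * hauptmodul ^ i) +
        (25 : ℕ) * (levelUnit ^ (n + 1 + 4) * hauptmodul ^ i) := by
      rw [pow_succ hauptmodul]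
      nth_rw 2 [hauptmodul_eq]
      push_cast
      ring
    rw [key]
    simp only [map_add, extract_natCast_mul]
    norm_cast

theorem extract_levelUnit_pow_mul_mem {e e' : ℕ → ℕ} (r : ℕ)
    (h : ∀ i j, e' i ≤ e j + unitExp (r + (j + 1)) i) {f : ℤ⟦X⟧} (hf : f ∈ hauptSpan e) :
    extract 5 0 (levelUnit ^ r * f) ∈ hauptSpan e' := by
  refine map_mem_of_mem_hauptSpan
    ((extract 5 0).toAddMonoidHom.comp (AddMonoidHom.mulLeft (levelUnit ^ r))) (fun j => ?_) hf
  have := five_pow_mul_mem_hauptSpan (fun i => h i j)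
    (extract_levelUnit_pow_mul_hauptmodul_pow_mem (j + 1) r (by omega))
  rw [← extract_natCast_mul, mul_left_comm] at this
  exact this

theorem exists_eq_mul_of_mem_hauptSpan {e : ℕ → ℕ} {c : ℕ} (h : ∀ i, c ≤ e i) {f : ℤ⟦X⟧}
    (hf : f ∈ hauptSpan e) : ∃ g, f = ((5 ^ c : ℕ) : ℤ⟦X⟧) * g := by
  have := map_mem_of_mem_hauptSpan (S := (AddMonoidHom.mulLeft ((5 ^ c : ℕ) : ℤ⟦X⟧)).range)
    (AddMonoidHom.id _) (fun i => ?_) hf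
  · obtain ⟨g, hg⟩ := this
    exact ⟨g, hg.symm⟩
  · obtain ⟨d, hd⟩ := Nat.exists_eq_add_of_le (h i)
    refine ⟨((5 ^ d : ℕ) : ℤ⟦X⟧) * hauptmodul ^ (i + 1), ?_⟩
    rw [hd, AddMonoidHom.id_apply, AddMonoidHom.coe_mulLeft, pow_add]
    push_cast
    ring

end Filtration

/-! ### Generating functions -/

section GeneratingFunctions

open PowerSeries.WithPiTopology

theorem powerSeriesMk_card_restricted_dvd_mul_expand {m : ℕ} (hm : m ≠ 0) :
    (PowerSeries.mk fun n => (#(Nat.Partition.restricted n (m ∣ ·)) : ℤ)) * expand m hm euler =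
      1 := by
  have h1 := Nat.Partition.hasProd_powerSeriesMk_card_restricted ℤ (m ∣ ·)
  have h2 := hasProd_extend_mul hm (f := fun n => (1 - X ^ n : ℤ⟦X⟧))
    (hasProd_expand_pentagonalSeries m hm)
  refine (h1.mul h2).unique ?_
  convert hasProd_one using 2 with n
  split_ifs
  · simp_rw [pow_mul]
    exact tsum_pow_mul_one_sub_of_constantCoeff_eq_zero (by simp)
  · exact one_mul 1

theorem powerSeriesMk_p1_mul (m : ℕ) (hm : m ≠ 0) :
    expand m hm euler * (PowerSeries.mk fun n => (p1 m n : ℤ)) = eulerInv := by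
  have h1 := powerSeriesMk_card_restricted_dvd_mul_expand (m := 1) one_ne_zero
  have hm' := powerSeriesMk_card_restricted_dvd_mul_expand hm
  rw [expand_one_apply] at h1
  have hp : (PowerSeries.mk fun n => (p1 m n : ℤ)) =
      (PowerSeries.mk fun n => (#(Nat.Partition.restricted n (1 ∣ ·)) : ℤ)) *
      PowerSeries.mk fun n => (#(Nat.Partition.restricted n (m ∣ ·)) : ℤ) := by
    ext n
    rw [coeff_mul, coeff_mk, p1, Nat.sum_antidiagonal_eq_sum_range_succ_mk]
    push_cast
    refine sum_congr rfl fun a _ => ?_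
    simp only [coeff_mk, Nat.Partition.restricted, Fintype.card_subtype, one_dvd, implies_true,
      filter_true, card_univ]
  rw [hp]
  linear_combination (PowerSeries.mk fun n => (#(Nat.Partition.restricted n (1 ∣ ·)) : ℤ)) * hm' -
    (PowerSeries.mk fun n => (#(Nat.Partition.restricted n (1 ∣ ·)) : ℤ)) * euler_mul_eulerInv +
    eulerInv * h1

end GeneratingFunctions

/-! ### Iteration of the `U` operator -/

section Iteration

theorem extract_X_pow_mul_expand_mul {R : Type*} [CommRing R] {m r s : ℕ} (hm : m ≠ 0)
    (h : r + s = m) (hr : r < m) (f g : R⟦X⟧) :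
    extract m 0 (X ^ s * (expand m hm f * g)) = X * (f * extract m r g) := by
  rw [mul_left_comm, extract_expand_mul hm (by omega), extract_X_pow_mul h _ hr, mul_left_comm]

/-- The exponents of `5` in the expansions of series attached to level `1`. -/
def evenExp (c i : ℕ) : ℕ := c + (5 * i + 1) / 2

/-- The exponents of `5` in the expansions of series attached to level `5`. -/
def oddExp (c i : ℕ) : ℕ := c + 5 * i / 2

theorem extract_four_mem {c : ℕ} {G : ℤ⟦X⟧} (h : X * (euler5 * G) ∈ hauptSpan (oddExp c)) :
    X * (euler * extract 5 4 G) ∈ hauptSpan (evenExp (c + 1)) := by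
  have := extract_levelUnit_pow_mul_mem 0 (e' := evenExp (c + 1))
    (fun i j => by
      unfold evenExp oddExp unitExp
      rcases Nat.eq_zero_or_pos j with rfl | hj <;> omega) h
  rwa [pow_zero, one_mul, euler5, ← pow_one X,
    extract_X_pow_mul_expand_mul (m := 5) (by norm_num) (r := 4) rfl (by norm_num)] at this

theorem extract_three_mem {c : ℕ} {G : ℤ⟦X⟧} (h : X * (euler * G) ∈ hauptSpan (evenExp c)) :
    X * (euler5 * extract 5 3 G) ∈ hauptSpan (oddExp (c + 1)) := by
  have := extract_levelUnit_pow_mul_mem 1 (e' := oddExp (c + 1))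
    (fun i j => by unfold evenExp oddExp unitExp; omega) h
  have key : levelUnit ^ 1 * (X * (euler * G)) = X ^ 2 * (expand 5 (by norm_num) euler5 * G) := by
    rw [expand_five_euler5]
    linear_combination X * G * levelUnit_mul_euler
  rwa [key, extract_X_pow_mul_expand_mul (m := 5) (by norm_num) (r := 3) rfl (by norm_num)] at this

theorem extract_two_mem {c : ℕ} {G : ℤ⟦X⟧} (h : X * (euler ^ 2 * G) ∈ hauptSpan (evenExp c)) :
    X * (euler5 ^ 2 * extract 5 2 G) ∈ hauptSpan (evenExp c) := by
  have := extract_levelUnit_pow_mul_mem 2 (e' := evenExp c)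
    (fun i j => by unfold evenExp unitExp; omega) h
  have key : levelUnit ^ 2 * (X * (euler ^ 2 * G)) =
      X ^ 3 * (expand 5 (by norm_num) (euler5 ^ 2) * G) := by
    rw [map_pow, expand_five_euler5]
    linear_combination X * G * (levelUnit * euler + X * euler25) * levelUnit_mul_euler
  rwa [key, extract_X_pow_mul_expand_mul (m := 5) (by norm_num) (r := 2) rfl (by norm_num)] at this

theorem extract_four_mem_of_sq {c : ℕ} {G : ℤ⟦X⟧}
    (h : X * (euler5 ^ 2 * G) ∈ hauptSpan (evenExp c)) :
    X * (euler ^ 2 * extract 5 4 G) ∈ hauptSpan (evenExp (c + 1)) := by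
  have := extract_levelUnit_pow_mul_mem 0 (e' := evenExp (c + 1))
    (fun i j => by unfold evenExp unitExp; omega) h
  rwa [pow_zero, one_mul, euler5, ← map_pow, ← pow_one X,
    extract_X_pow_mul_expand_mul (m := 5) (by norm_num) (r := 4) rfl (by norm_num)] at this

/-- The inverse of `24` modulo `25 ^ k`. -/
def partitionShift : ℕ → ℕ
  | 0 => 1
  | k + 1 => 25 ^ k * 23 + partitionShift k

theorem partitionShift_eq (k : ℕ) : 24 * partitionShift k = 23 * 25 ^ k + 1 := by
  induction k with
  | zero => rfl
  | succ k ih => rw [partitionShift, mul_add, ih]; ring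

/-- The shift by which the iterated progressions modulo `25` in the class of `22` are displaced. -/
def twoColorShift : ℕ → ℕ
  | 0 => 0
  | b + 1 => 25 ^ b * 22 + twoColorShift b

theorem twoColorShift_eq (b : ℕ) : 24 * twoColorShift b + 22 = 22 * 25 ^ b := by
  induction b with
  | zero => rfl
  | succ b ih => rw [twoColorShift, mul_add, add_assoc, ih]; ring

theorem extract_eulerInv_mem (k : ℕ) :
    X * (euler * extract (25 ^ (k + 1)) (partitionShift (k + 1)) eulerInv) ∈
      hauptSpan (evenExp (2 * (k + 1))) := by
  induction k with
  | zero =>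
    have h := extract_levelUnit_pow_mem 0
    have key : levelUnit ^ (0 + 1) = X ^ 1 * (expand 5 (by norm_num) euler5 * eulerInv) := by
      rw [expand_five_euler5, levelUnit]
      ring
    rw [key, extract_X_pow_mul_expand_mul (m := 5) (by norm_num) (r := 4) rfl (by norm_num)] at h
    have := extract_four_mem (c := 1)
      (hauptSpan_mono (fun i => by unfold oddExp unitExp; omega) h)
    rwa [extract_extract] at this
  | succ k ih =>
    have := extract_four_mem (extract_three_mem ih)
    rw [extract_extract, extract_extract] at this
    rwa [show 25 ^ (k + 1) * (5 * 5) = 25 ^ (k + 1 + 1) by ring,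
      show 25 ^ (k + 1) * (5 * 4 + 3) + partitionShift (k + 1) =
        partitionShift (k + 1 + 1) by rw [partitionShift.eq_2 (k + 1)]] at this

theorem extract_iterate_mem (b : ℕ) {c : ℕ} {G : ℤ⟦X⟧}
    (h : X * (euler ^ 2 * G) ∈ hauptSpan (evenExp c)) :
    X * (euler ^ 2 * extract (25 ^ b) (twoColorShift b) G) ∈ hauptSpan (evenExp (c + b)) := by
  induction b with
  | zero =>
    have hG : extract (25 ^ 0) (twoColorShift 0) G = G := by
      ext n
      simp [twoColorShift]
    rwa [hG]
  | succ b ih =>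
    have := extract_four_mem_of_sq (extract_two_mem ih)
    rw [extract_extract, extract_extract] at this
    rwa [show 25 ^ b * (5 * 5) = 25 ^ (b + 1) by ring,
      show 25 ^ b * (5 * 4 + 2) + twoColorShift b = twoColorShift (b + 1) by
        rw [twoColorShift]] at this

theorem dvd_coeff_of_X_mul_euler_sq_mul_mem {c : ℕ} {G : ℤ⟦X⟧}
    (h : X * (euler ^ 2 * G) ∈ hauptSpan (evenExp c)) (n : ℕ) : ((5 ^ c : ℕ) : ℤ) ∣ coeff n G := by
  obtain ⟨g, hg⟩ := exists_eq_mul_of_mem_hauptSpan (fun i => Nat.le_add_right c _) h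
  have hX : X * G = C ((5 ^ c : ℕ) : ℤ) * (g * eulerInv ^ 2) := by
    rw [map_natCast]
    linear_combination eulerInv ^ 2 * hg - X * G * (euler * eulerInv + 1) * euler_mul_eulerInv
  rw [← coeff_succ_X_mul, hX, coeff_C_mul]
  exact dvd_mul_right _ _

theorem five_pow_dvd_p1 (n b k : ℕ) :
    5 ^ (2 * (k + 1) + b) ∣ p1 (25 ^ (k + 1))
      (25 ^ (k + 1) * (25 ^ b * n + twoColorShift b) + partitionShift (k + 1)) := by
  have hlt : partitionShift (k + 1) < 25 ^ (k + 1) := by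
    have := partitionShift_eq (k + 1)
    have : 1 < 25 ^ (k + 1) := Nat.one_lt_pow (by omega) (by norm_num)
    omega
  have h := extract_eulerInv_mem k
  rw [← powerSeriesMk_p1_mul (25 ^ (k + 1)) (by positivity), extract_expand_mul _ hlt,
    ← mul_assoc euler, ← sq] at h
  have := dvd_coeff_of_X_mul_euler_sq_mul_mem (extract_iterate_mem b h) n
  rw [coeff_extract, coeff_extract, coeff_mk] at this
  exact_mod_cast this

end Iteration

end TwoColor

/-- For all `n, β ≥ 0` and `k ≥ 1`, `24` divides `22·5^{2k+2β} + 5^{2k} + 1` and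
`p_{1,5^{2k}}(5^{2k+2β} n + (22·5^{2k+2β} + 5^{2k} + 1)/24) ≡ 0 (mod 5^{2k+β})`. -/
theorem twoColorCongruence_even_b (n β k : ℕ) (hk : 1 ≤ k) :
    24 ∣ 22 * 5 ^ (2 * k + 2 * β) + 5 ^ (2 * k) + 1 ∧
      5 ^ (2 * k + β) ∣
        p1 (5 ^ (2 * k))
          (5 ^ (2 * k + 2 * β) * n +
            (22 * 5 ^ (2 * k + 2 * β) + 5 ^ (2 * k) + 1) / 24) := by
  obtain ⟨k, rfl⟩ := Nat.exists_eq_add_of_le' hk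
  have h25 : ∀ j, 5 ^ (2 * j) = 25 ^ j := fun j => by rw [pow_mul]; norm_num
  have key : 22 * 5 ^ (2 * (k + 1) + 2 * β) + 5 ^ (2 * (k + 1)) + 1 =
      24 * (25 ^ (k + 1) * TwoColor.twoColorShift β + TwoColor.partitionShift (k + 1)) := by
    have h1 := TwoColor.partitionShift_eq (k + 1)
    have h2 := TwoColor.twoColorShift_eq β
    rw [pow_add, h25, h25]
    linear_combination 25 ^ (k + 1) * h2.symm + h1.symm
  refine ⟨key ▸ dvd_mul_right _ _, ?_⟩
  rw [key, Nat.mul_div_cancel_left _ (by norm_num)]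
  convert TwoColor.five_pow_dvd_p1 n β k using 2
  · exact h25 _
  · rw [pow_add, h25, h25]
    ring
end
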